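/- For every N ≥ 2, θ ∈ (0, π/2], ã > 0 and d > 0 there exists a constant C > 0, depending only on N, θ, ã and d, such that the following holds: for every bounded domain Ω ⊂ ℝ^N with diameter at most d satisfying the (θ,ã)-uniform interior cone condition and every torsion function u on Ω which is C¹ up to the boundary with ∫_Ω |∇²u|² dx < ∞, setting z the barycenter of Ω, h(x) := |x−z|²/2 − u(x), ρ_e := max_{x∈∂Ω}|x−z|, ρ_i := min_{x∈∂Ω}|x−z|, A := (∫_Ω dist(x,∂Ω)² |∇²h|² dx)^{1/2} and M := sup_Ω |∇h|, one has: ρ_e − ρ_i ≤ C A max(log(e M / A), 1) if N = 2, and ρ_e − ρ_i ≤ C M^{(N−2)/N} A^{2/N} if N ≥ 3. -/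

import Mathlib

open MeasureTheory Metric Set Real RealInnerProductSpace

noncomputable section

/-- Euclidean space `ℝ^N`. -/
abbrev Euc (N : ℕ) : Type := EuclideanSpace ℝ (Fin N)

/-- The `(i,j)` entry of the Hessian matrix of `u` at `x`. -/
def hessEntry {N : ℕ} (u : Euc N → ℝ) (x : Euc N) (i j : Fin N) : ℝ :=
  fderiv ℝ (fun y => fderiv ℝ u y (EuclideanSpace.single j (1 : ℝ))) x
    (EuclideanSpace.single i (1 : ℝ))

/-- Squared Frobenius norm of the Hessian of `u` at `x`. -/
def hessNormSq {N : ℕ} (u : Euc N → ℝ) (x : Euc N) : ℝ :=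
  ∑ i, ∑ j, (hessEntry u x i j) ^ 2

/-- The Laplacian of `u` at `x` (trace of the Hessian). -/
def lap {N : ℕ} (u : Euc N → ℝ) (x : Euc N) : ℝ := ∑ i, hessEntry u x i i

/-- `u` is a torsion function on `Ω`: continuous on the closure, `C²` inside,
`Δu = N` in `Ω` and `u = 0` on `∂Ω`. -/
def IsTorsion {N : ℕ} (Ω : Set (Euc N)) (u : Euc N → ℝ) : Prop :=
  ContinuousOn u (closure Ω) ∧ ContDiffOn ℝ 2 u Ω ∧
    (∀ x ∈ Ω, lap u x = N) ∧ ∀ x ∈ frontier Ω, u x = 0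

/-- `G` is a `b₀`-John domain. -/
def IsJohn {N : ℕ} (b₀ : ℝ) (G : Set (Euc N)) : Prop :=
  ∀ a ∈ G, ∀ b ∈ G, a ≠ b → ∃ γ : ℝ → Euc N,
    ContinuousOn γ (Icc 0 1) ∧ γ 0 = a ∧ γ 1 = b ∧ (∀ t ∈ Icc (0:ℝ) 1, γ t ∈ G) ∧
    ∀ t ∈ Icc (0:ℝ) 1, b₀⁻¹ * min (dist (γ t) a) (dist (γ t) b) ≤ infDist (γ t) (frontier G)

/-- `(θ, a)`-uniform interior cone condition. -/
def UnifConeCond {N : ℕ} (θ a : ℝ) (G : Set (Euc N)) : Prop :=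
  ∀ x ∈ frontier G, ∃ ω : Euc N, ‖ω‖ = 1 ∧
    ∀ w ∈ ball x a ∩ closure G, ∀ y : Euc N,
      ⟪y, ω⟫ > ‖y‖ * Real.cos θ → ‖y‖ < a → w + y ∈ G

/-- `r`-uniform interior sphere condition. -/
def IntSphere {N : ℕ} (r : ℝ) (Ω : Set (Euc N)) : Prop :=
  ∀ x ∈ frontier Ω, ∃ c : Euc N, ball c r ⊆ Ω ∧ dist x c = r

/-- `r`-uniform exterior sphere condition. -/
def ExtSphere {N : ℕ} (r : ℝ) (Ω : Set (Euc N)) : Prop :=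
  ∀ x ∈ frontier Ω, ∃ c : Euc N, ball c r ⊆ (closure Ω)ᶜ ∧ dist x c = r

open scoped ENNReal NNReal

/-- The ball of radius `r` around `c` is reached from every point of `closure Ω` near `p` through
a solid cone contained in `Ω`. -/
def ReachesBall {N : ℕ} (r : ℝ) (Ω : Set (Euc N)) (p c : Euc N) : Prop :=
  ∀ x ∈ ball p r ∩ closure Ω, ∀ q ∈ ball c r, ∀ τ ∈ Ioc (0 : ℝ) 1,
    ball (x + τ • (q - x)) (τ * r) ⊆ Ω

theorem inner_gt_of_norm_sub_lt {E : Type*} [NormedAddCommGroup E] [InnerProductSpace ℝ E]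
    {ω ζ : E} {s c : ℝ} (hω : ‖ω‖ = 1) (hc0 : 0 ≤ c) (hc1 : c < 1) (hs : 0 < s)
    (hζ : ‖ζ‖ < (1 - c) / 2 * s) : ⟪s • ω + ζ, ω⟫ > ‖s • ω + ζ‖ * c := by
  have h1 : ⟪s • ω + ζ, ω⟫ = s + ⟪ζ, ω⟫ := by
    rw [inner_add_left, real_inner_smul_left, real_inner_self_eq_norm_sq, hω]; ring
  have h2 : -‖ζ‖ ≤ ⟪ζ, ω⟫ := by
    have := abs_real_inner_le_norm ζ ω
    rw [hω, mul_one] at this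
    exact (abs_le.1 this).1
  have h3 : ‖s • ω + ζ‖ ≤ s + ‖ζ‖ := by
    refine (norm_add_le _ _).trans ?_
    rw [norm_smul, hω, Real.norm_of_nonneg hs.le, mul_one]
  have h4 : ‖s • ω + ζ‖ * c ≤ (s + ‖ζ‖) * c := mul_le_mul_of_nonneg_right h3 hc0
  have h5 : ‖ζ‖ * (1 + c) ≤ ‖ζ‖ * 2 := mul_le_mul_of_nonneg_left (by linarith) (norm_nonneg _)
  rw [h1]
  nlinarith

theorem exists_local_cone {N : ℕ} (hN : 1 ≤ N) {θ a : ℝ} (ha : 0 < a) {Ω : Set (Euc N)}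
    (hΩ : IsOpen Ω) (hne : Ω ≠ univ) (hcone : UnifConeCond θ a Ω) {p : Euc N}
    (hp : p ∈ closure Ω) :
    ∃ ω : Euc N, ‖ω‖ = 1 ∧ ∀ w ∈ ball p (a / 4) ∩ closure Ω, ∀ y : Euc N,
      ⟪y, ω⟫ > ‖y‖ * Real.cos θ → ‖y‖ < a / 4 → w + y ∈ Ω := by
  by_cases hfar : ball p (a / 2) ⊆ Ω
  · have : Nontrivial (Euc N) := by
      have : Nonempty (Fin N) := ⟨⟨0, hN⟩⟩
      infer_instance
    obtain ⟨ω, hω⟩ := exists_norm_eq (Euc N) zero_le_one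
    refine ⟨ω, hω, fun w hw y _ hy => hfar ?_⟩
    have h1 : dist w p < a / 4 := hw.1
    rw [mem_ball, dist_eq_norm] at *
    calc ‖w + y - p‖ = ‖(w - p) + y‖ := by congr 1; abel
      _ ≤ ‖w - p‖ + ‖y‖ := norm_add_le _ _
      _ < a / 2 := by linarith
  · obtain ⟨x, hx, hxp⟩ : ∃ x ∈ frontier Ω, dist p x < a / 2 := by
      by_cases hpΩ : p ∈ Ω
      · obtain ⟨y, hy, hpy⟩ := exists_mem_frontier_infDist_compl_eq_dist hpΩ hne
        refine ⟨y, hy, ?_⟩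
        by_contra! hcon
        rw [← hpy] at hcon
        exact hfar ((ball_subset_ball hcon).trans ball_infDist_compl_subset)
      · exact ⟨p, by rw [hΩ.frontier_eq]; exact ⟨hp, hpΩ⟩, by simpa using half_pos ha⟩
    obtain ⟨ω, hω, H⟩ := hcone x hx
    refine ⟨ω, hω, fun w hw y h1 h2 => H w ⟨?_, hw.2⟩ y h1 (by linarith)⟩
    have h3 : dist w p < a / 4 := hw.1
    exact (dist_triangle w p x).trans_lt (by linarith)

theorem exists_reachesBall {N : ℕ} (hN : 1 ≤ N) {θ a : ℝ} (hθ : θ ∈ Ioc (0 : ℝ) (π / 2))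
    (ha : 0 < a) : ∃ r > 0, ∀ Ω : Set (Euc N), IsOpen Ω → Ω ≠ univ → UnifConeCond θ a Ω →
      ∀ p ∈ closure Ω, ∃ c, ReachesBall r Ω p c := by
  have hc0 : 0 ≤ Real.cos θ := Real.cos_nonneg_of_mem_Icc ⟨by linarith [hθ.1, Real.pi_pos], hθ.2⟩
  have hc1 : Real.cos θ < 1 := by
    rw [← Real.cos_zero]
    exact Real.cos_lt_cos_of_nonneg_of_le_pi le_rfl (by linarith [hθ.2, Real.pi_pos]) hθ.1
  set s : ℝ := a / 8 with hs
  set r : ℝ := (1 - Real.cos θ) / 2 * s / 3 with hr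
  have hs0 : 0 < s := by positivity
  have hr0 : 0 < r := by have : 0 < 1 - Real.cos θ := by linarith
                         positivity
  have hrs : 3 * r ≤ s / 2 := by rw [hr]; nlinarith
  refine ⟨r, hr0, fun Ω hΩ hne hcone p hp => ?_⟩
  obtain ⟨ω, hω, H⟩ := exists_local_cone hN ha hΩ hne hcone hp
  refine ⟨p + s • ω, fun x hx q hq τ hτ z hz => ?_⟩
  have hx1 : dist x p < r := hx.1
  rw [dist_eq_norm] at hx1
  rw [mem_ball, dist_eq_norm] at hq hz
  set ζ : Euc N := τ⁻¹ • (z - x) - s • ω with hζ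
  have hτ0 : 0 < τ := hτ.1
  have hzx : z = x + τ • (s • ω + ζ) := by
    rw [hζ]; simp [smul_smul, hτ0.ne']
  have hζ' : ζ = τ⁻¹ • (z - (x + τ • (q - x))) + (q - (p + s • ω)) - (x - p) := by
    rw [hζ]
    have : τ⁻¹ • (z - (x + τ • (q - x))) = τ⁻¹ • (z - x) - (q - x) := by
      rw [← sub_sub, smul_sub, smul_smul, inv_mul_cancel₀ hτ0.ne', one_smul]
    rw [this]; abel
  have h1 : ‖τ⁻¹ • (z - (x + τ • (q - x)))‖ < r := by
    rw [norm_smul, norm_inv, Real.norm_of_nonneg hτ0.le, inv_mul_lt_iff₀ hτ0]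
    exact hz
  have hζn : ‖ζ‖ < (1 - Real.cos θ) / 2 * s := by
    have : (1 - Real.cos θ) / 2 * s = 3 * r := by rw [hr]; ring
    rw [this, hζ']
    refine (norm_sub_le _ _).trans_lt ?_
    have := norm_add_le (τ⁻¹ • (z - (x + τ • (q - x)))) (q - (p + s • ω))
    linarith
  rw [hzx]
  refine H x ⟨?_, hx.2⟩ _ ?_ ?_
  · rw [mem_ball, dist_eq_norm]; linarith
  · rw [real_inner_smul_left, norm_smul, Real.norm_of_nonneg hτ0.le, mul_assoc]
    exact mul_lt_mul_of_pos_left (inner_gt_of_norm_sub_lt hω hc0 hc1 hs0 hζn) hτ0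
  · have h3 : ‖s • ω + ζ‖ ≤ s + ‖ζ‖ := by
      refine (norm_add_le _ _).trans ?_
      rw [norm_smul, hω, Real.norm_of_nonneg hs0.le, mul_one]
    have h4 : (1 - Real.cos θ) / 2 * s = 3 * r := by rw [hr]; ring
    rw [norm_smul, Real.norm_of_nonneg hτ0.le]
    have := mul_le_of_le_one_left (norm_nonneg (s • ω + ζ)) hτ.2
    linarith

namespace ReachesBall

variable {N : ℕ} {r : ℝ} {Ω : Set (Euc N)} {p c : Euc N}

theorem mem (H : ReachesBall r Ω p c) (hr : 0 < r) {x q : Euc N}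
    (hx : x ∈ ball p r ∩ closure Ω) (hq : q ∈ ball c r) {τ : ℝ} (hτ : τ ∈ Ioc (0 : ℝ) 1) :
    x + τ • (q - x) ∈ Ω :=
  H x hx q hq τ hτ (mem_ball_self (mul_pos hτ.1 hr))

theorem ball_subset (H : ReachesBall r Ω p c) (hr : 0 < r) (hp : p ∈ closure Ω) :
    ball c r ⊆ Ω := fun q hq => by
  simpa using H.mem hr ⟨mem_ball_self hr, hp⟩ hq (τ := 1) (by simp)

theorem le_infDist (H : ReachesBall r Ω p c) (hΩ : IsOpen Ω) (hfr : (frontier Ω).Nonempty)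
    {x q : Euc N} (hx : x ∈ ball p r ∩ closure Ω) (hq : q ∈ ball c r) {τ : ℝ}
    (hτ : τ ∈ Ioc (0 : ℝ) 1) :
    τ * r ≤ infDist (x + τ • (q - x)) (frontier Ω) := by
  refine (Metric.le_infDist hfr).2 fun y hy => ?_
  by_contra! hcon
  have : y ∈ Ω := H x hx q hq τ hτ (by rwa [mem_ball, dist_comm])
  rw [hΩ.frontier_eq] at hy
  exact hy.2 this

theorem exists_ball_subset (H : ReachesBall r Ω p c) (hr : 0 < r) {d : ℝ} (hd : 0 < d)
    (hbd : Bornology.IsBounded Ω) (hdiam : diam Ω ≤ d) (hp : p ∈ Ω) :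
    ∃ y, ball y (r / (d + r) / 2 * r) ⊆ Ω ∩ ball p r := by
  set τ : ℝ := r / (d + r) / 2
  have hτ0 : 0 < τ := by positivity
  have hτ1 : τ ≤ 1 := by
    have : r / (d + r) ≤ 1 := by rw [div_le_one (by positivity)]; linarith
    simp only [τ]; linarith
  have hτr : τ * (d + r) = r / 2 := by simp only [τ]; field_simp
  have hpc : p ∈ closure Ω := subset_closure hp
  have hc : dist p c ≤ d :=
    (dist_le_diam_of_mem hbd hp (H.ball_subset hr hpc (mem_ball_self hr))).trans hdiam
  refine ⟨p + τ • (c - p), subset_inter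
    (H p ⟨mem_ball_self hr, hpc⟩ c (mem_ball_self hr) τ ⟨hτ0, hτ1⟩) (ball_subset_ball' ?_)⟩
  rw [dist_eq_norm, add_sub_cancel_left, norm_smul, Real.norm_of_nonneg hτ0.le, ← dist_eq_norm,
    dist_comm]
  nlinarith [mul_le_mul_of_nonneg_left hc hτ0.le]

end ReachesBall

theorem exists_ray_mem_frontier {N : ℕ} {Ω : Set (Euc N)} (hΩ : IsOpen Ω)
    (hbd : Bornology.IsBounded Ω) {c e : Euc N} (he : ‖e‖ = 1) (hc : c ∈ Ω) :
    ∃ t : ℝ, 0 ≤ t ∧ c + t • e ∈ frontier Ω := by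
  by_contra! hcon
  set S : Set (Euc N) := (fun t : ℝ => c + t • e) '' Ici 0
  have hS : IsPreconnected S := isPreconnected_Ici.image _ (by fun_prop)
  have hsub : S ⊆ Ω := by
    refine hS.subset_of_closure_inter_subset hΩ ⟨c, ⟨0, by simp, by simp⟩, hc⟩ ?_
    rintro _ ⟨hcl, t, ht, rfl⟩
    by_contra hn
    exact hcon t ht (by rw [hΩ.frontier_eq]; exact ⟨hcl, hn⟩)
  obtain ⟨R, hR⟩ := (hbd.subset_ball_lt 0 c)
  have h1 := hR.2 (hsub ⟨R, hR.1.le, rfl⟩)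
  rw [mem_ball, dist_eq_norm, add_sub_cancel_left, norm_smul, he, mul_one,
    Real.norm_of_nonneg hR.1.le] at h1
  exact lt_irrefl _ h1

/-- A bounded open set containing a ball of radius `r` has a boundary point at distance at least
`r` from any given point. -/
theorem exists_frontier_le_dist {N : ℕ} (hN : 1 ≤ N) {Ω : Set (Euc N)} (hΩ : IsOpen Ω)
    (hbd : Bornology.IsBounded Ω) {c : Euc N} {r : ℝ} (hr : 0 < r) (hc : ball c r ⊆ Ω)
    (z : Euc N) : ∃ x ∈ frontier Ω, r ≤ dist x z := by
  have : Nontrivial (Euc N) := by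
    have : Nonempty (Fin N) := ⟨⟨0, hN⟩⟩
    infer_instance
  obtain ⟨e, he, hcz⟩ : ∃ e : Euc N, ‖e‖ = 1 ∧ c - z = ‖c - z‖ • e := by
    by_cases h0 : c - z = 0
    · obtain ⟨e, he⟩ := exists_norm_eq (Euc N) zero_le_one
      exact ⟨e, he, by simp [h0]⟩
    · have h1 : ‖c - z‖ ≠ 0 := by simpa using h0
      refine ⟨‖c - z‖⁻¹ • (c - z), ?_, ?_⟩
      · rw [norm_smul, norm_inv, norm_norm, inv_mul_cancel₀ h1]
      · rw [smul_smul, mul_inv_cancel₀ h1, one_smul]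
  obtain ⟨t, ht, hfr⟩ := exists_ray_mem_frontier hΩ hbd he (hc (mem_ball_self hr))
  refine ⟨_, hfr, ?_⟩
  have h1 : r ≤ t := by
    by_contra! hlt
    have : c + t • e ∈ Ω := hc (by
      rwa [mem_ball, dist_eq_norm, add_sub_cancel_left, norm_smul, he, mul_one,
        Real.norm_of_nonneg ht])
    rw [hΩ.frontier_eq] at hfr
    exact hfr.2 this
  have h2 : c + t • e - z = (‖c - z‖ + t) • e := by
    rw [add_smul, ← hcz]; abel
  rw [dist_eq_norm, h2, norm_smul, he, mul_one, Real.norm_of_nonneg (by positivity)]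
  linarith [norm_nonneg (c - z)]

theorem enorm_sub_le_lintegral_segment {N : ℕ} {F : Type*} [NormedAddCommGroup F]
    [NormedSpace ℝ F] [CompleteSpace F] {f : Euc N → F} {x q : Euc N} {t : ℝ} (ht : t ≤ 1)
    (hc : ContinuousOn (fun τ : ℝ => f (x + τ • (q - x))) (Icc t 1))
    (hd : ∀ τ ∈ Ioo t 1, DifferentiableAt ℝ f (x + τ • (q - x))) :
    ‖f q - f (x + t • (q - x))‖ₑ ≤
      ‖q - x‖ₑ * ∫⁻ τ in Ioc t 1, ‖fderiv ℝ f (x + τ • (q - x))‖ₑ := by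
  set γ : ℝ → F := fun τ => f (x + τ • (q - x)) with hγ
  have hder : ∀ τ ∈ Ioo t 1, HasDerivAt γ (fderiv ℝ f (x + τ • (q - x)) (q - x)) τ := by
    intro τ hτ
    have h1 : HasDerivAt (fun τ : ℝ => x + τ • (q - x)) (q - x) τ := by
      simpa using ((hasDerivAt_id τ).smul_const (q - x)).const_add x
    exact (hd τ hτ).hasFDerivAt.comp_hasDerivAt τ h1
  have hle : ∫⁻ τ in Ioc t 1, ‖deriv γ τ‖ₑ ≤
      ‖q - x‖ₑ * ∫⁻ τ in Ioc t 1, ‖fderiv ℝ f (x + τ • (q - x))‖ₑ := by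
    have hm : Measurable fun τ : ℝ => ‖fderiv ℝ f (x + τ • (q - x))‖ₑ :=
      ((measurable_fderiv ℝ f).comp (by fun_prop)).enorm
    rw [← lintegral_const_mul _ hm, ← restrict_Ioo_eq_restrict_Ioc]
    refine setLIntegral_mono' measurableSet_Ioo fun τ hτ => ?_
    rw [(hder τ hτ).deriv, mul_comm]
    exact ContinuousLinearMap.le_opENorm _ _
  have h1 : γ 1 = f q := by simp [hγ]
  by_cases hfin : ∫⁻ τ in Ioc t 1, ‖deriv γ τ‖ₑ = ∞
  · rw [hfin, top_le_iff] at hle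
    rw [hle]; exact le_top
  refine le_trans ?_ hle
  have hinteg : IntervalIntegrable (deriv γ) volume t 1 := by
    rw [intervalIntegrable_iff_integrableOn_Ioc_of_le ht]
    exact ⟨aestronglyMeasurable_deriv γ _, lt_top_iff_ne_top.2 hfin⟩
  have := intervalIntegral.integral_eq_sub_of_hasDerivAt_of_le ht hc
    (fun τ hτ => (hder τ hτ).differentiableAt.hasDerivAt) hinteg
  rw [← h1, ← this, intervalIntegral.integral_of_le ht]
  exact enorm_integral_le_lintegral_enorm _

theorem lintegral_comp_add_smul {N : ℕ} {k : Euc N → ℝ≥0∞} (hk : Measurable k) {σ : ℝ}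
    (hσ : 0 < σ) (v : Euc N) :
    ∫⁻ q, k (v + σ • q) = ENNReal.ofReal ((σ ^ N)⁻¹) * ∫⁻ z, k z := by
  have h1 : ∫⁻ q, k (v + σ • q) = ∫⁻ z, k (v + z) ∂(Measure.map (σ • ·) volume) := by
    rw [lintegral_map (by fun_prop) (by fun_prop)]
  rw [h1, Measure.map_addHaar_smul _ hσ.ne', lintegral_smul_measure, finrank_euclideanSpace_fin,
    abs_of_pos (by positivity), lintegral_add_left_eq_self, smul_eq_mul]

theorem lintegral_comp_homothety {N : ℕ} {k : Euc N → ℝ≥0∞} (hk : Measurable k) {σ : ℝ}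
    (hσ : 0 < σ) (x : Euc N) :
    ∫⁻ q, k (x + σ • (q - x)) = ENNReal.ofReal ((σ ^ N)⁻¹) * ∫⁻ z, k z := by
  rw [← lintegral_comp_add_smul hk hσ (x - σ • x)]
  congr 1 with q
  rw [smul_sub]; congr 1; abel

theorem ofReal_inv_pow_le {N : ℕ} {σ : ℝ} (hσ : 1 / 2 ≤ σ) :
    ENNReal.ofReal ((σ ^ N)⁻¹) ≤ 2 ^ N := by
  rw [← ENNReal.ofReal_ofNat 2, ← ENNReal.ofReal_pow (by norm_num), ← inv_pow]
  refine ENNReal.ofReal_le_ofReal (pow_le_pow_left₀ (by positivity) ?_ N)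
  rw [inv_le_comm₀ (by positivity) (by norm_num)]
  linarith

/-- Averaging over segments joining two sets of small measure. -/
theorem lintegral_segments_le {N : ℕ} {k : ℝ → Euc N → ℝ≥0∞} (hk : Measurable (Function.uncurry k))
    {U B : Set (Euc N)} {m : ℝ≥0∞} (hU : volume U ≤ m) (hB : volume B ≤ m)
    (hU' : volume U ≠ ∞) (hB' : volume B ≠ ∞) :
    ∫⁻ x in U, ∫⁻ q in B, ∫⁻ τ in Ioc (0 : ℝ) 1, k τ (x + τ • (q - x)) ≤
      2 ^ N * m * ∫⁻ τ in Ioc (0 : ℝ) 1, ∫⁻ z, k τ z := by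
  have : IsFiniteMeasure (volume.restrict U) := ⟨by simpa using hU'.lt_top⟩
  have : IsFiniteMeasure (volume.restrict B) := ⟨by simpa using hB'.lt_top⟩
  have hk' : ∀ τ, Measurable (k τ) := fun τ => hk.comp (by fun_prop : Measurable fun z => (τ, z))
  have e1 : ∫⁻ x in U, ∫⁻ q in B, ∫⁻ τ in Ioc (0 : ℝ) 1, k τ (x + τ • (q - x)) =
      ∫⁻ x in U, ∫⁻ τ in Ioc (0 : ℝ) 1, ∫⁻ q in B, k τ (x + τ • (q - x)) := by
    refine lintegral_congr fun x => lintegral_lintegral_swap ?_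
    exact (hk.comp (by fun_prop : Measurable fun y : Euc N × ℝ =>
      (y.2, x + y.2 • (y.1 - x)))).aemeasurable
  have e2 : ∫⁻ x in U, ∫⁻ τ in Ioc (0 : ℝ) 1, ∫⁻ q in B, k τ (x + τ • (q - x)) =
      ∫⁻ τ in Ioc (0 : ℝ) 1, ∫⁻ x in U, ∫⁻ q in B, k τ (x + τ • (q - x)) := by
    refine lintegral_lintegral_swap ?_
    refine (Measurable.lintegral_prod_right' (f := fun y : (Euc N × ℝ) × Euc N =>
      k y.1.2 (y.1.1 + y.1.2 • (y.2 - y.1.1))) ?_).aemeasurable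
    exact hk.comp (by fun_prop : Measurable fun y : (Euc N × ℝ) × Euc N =>
      (y.1.2, y.1.1 + y.1.2 • (y.2 - y.1.1)))
  have hm : Measurable fun τ => ∫⁻ z, k τ z := hk.lintegral_prod_right'
  rw [e1, e2, ← lintegral_const_mul _ hm]
  refine setLIntegral_mono' measurableSet_Ioc fun τ hτ => ?_
  rcases le_total (1 / 2) τ with h | h
  · calc ∫⁻ x in U, ∫⁻ q in B, k τ (x + τ • (q - x))
        ≤ ∫⁻ x in U, 2 ^ N * ∫⁻ z, k τ z := by
          refine lintegral_mono fun x => ?_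
          refine (setLIntegral_le_lintegral _ _).trans ?_
          rw [lintegral_comp_homothety (hk' τ) hτ.1]
          gcongr
          exact ofReal_inv_pow_le h
      _ = 2 ^ N * volume U * ∫⁻ z, k τ z := by rw [setLIntegral_const]; ring
      _ ≤ _ := by gcongr
  · rw [lintegral_lintegral_swap]
    · calc
        ∫⁻ q in B, ∫⁻ x in U, k τ (x + τ • (q - x))
        ≤ ∫⁻ q in B, 2 ^ N * ∫⁻ z, k τ z := by
          refine lintegral_mono fun q => ?_
          refine (setLIntegral_le_lintegral _ _).trans ?_
          have : ∀ x, x + τ • (q - x) = q + (1 - τ) • (x - q) := fun x => by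
            rw [sub_smul, one_smul, ← neg_sub q x, smul_neg]; abel
          simp_rw [this]
          rw [lintegral_comp_homothety (hk' τ) (by linarith)]
          gcongr
          exact ofReal_inv_pow_le (by linarith)
      _ = 2 ^ N * volume B * ∫⁻ z, k τ z := by rw [setLIntegral_const]; ring
      _ ≤ _ := by gcongr
    · exact ((hk' τ).comp (by fun_prop : Measurable fun y : Euc N × Euc N =>
        y.1 + τ • (y.2 - y.1))).aemeasurable

/-- The weighted integral `∫_Ω dist(z, ∂Ω) |Df(z)| dz`. -/
def weightedGrad {N : ℕ} {F : Type*} [NormedAddCommGroup F] [NormedSpace ℝ F] (Ω : Set (Euc N))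
    (f : Euc N → F) : ℝ≥0∞ :=
  ∫⁻ z in Ω, ENNReal.ofReal (infDist z (frontier Ω)) * ‖fderiv ℝ f z‖ₑ

theorem lintegral_cone_weight_le {N : ℕ} {F : Type*} [NormedAddCommGroup F] [NormedSpace ℝ F]
    {Ω : Set (Euc N)} {r : ℝ} (hr : 0 < r) (hΩ : IsOpen Ω) {g : Euc N → ℝ≥0∞}
    (hg : Measurable g) :
    ∫⁻ τ in Ioc (0 : ℝ) 1, ∫⁻ z, {y : ℝ × Euc N | y.2 ∈ Ω ∧ y.1 * r ≤ infDist y.2 (frontier Ω)}.indicator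
      (fun y => g y.2) (τ, z) ≤
    ENNReal.ofReal (1 / r) * ∫⁻ z in Ω, ENNReal.ofReal (infDist z (frontier Ω)) * g z := by
  have hS : MeasurableSet {y : ℝ × Euc N | y.2 ∈ Ω ∧ y.1 * r ≤ infDist y.2 (frontier Ω)} :=
    (hΩ.measurableSet.preimage measurable_snd).inter
      (measurableSet_le (by fun_prop) (measurable_infDist.comp measurable_snd))
  have hm : Measurable fun y : ℝ × Euc N =>
      {y : ℝ × Euc N | y.2 ∈ Ω ∧ y.1 * r ≤ infDist y.2 (frontier Ω)}.indicator
        (fun y => g y.2) y := (hg.comp measurable_snd).indicator hS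
  rw [lintegral_lintegral_swap hm.aemeasurable, ← lintegral_const_mul _ (by fun_prop),
    ← lintegral_indicator hΩ.measurableSet]
  refine lintegral_mono fun z => ?_
  by_cases hz : z ∈ Ω
  · rw [indicator_of_mem hz]
    calc _ ≤ ∫⁻ τ in Ioc (0 : ℝ) 1, (Iic (infDist z (frontier Ω) / r)).indicator
            (fun _ => g z) τ := by
          refine lintegral_mono fun τ => ?_
          by_cases h : τ * r ≤ infDist z (frontier Ω)
          · have hmem : (τ, z) ∈ {y : ℝ × Euc N | y.2 ∈ Ω ∧ y.1 * r ≤ infDist y.2 (frontier Ω)} :=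
              ⟨hz, h⟩
            rw [indicator_of_mem hmem, indicator_of_mem (by rw [mem_Iic, le_div_iff₀ hr]; exact h)]
          · rw [indicator_of_notMem (fun h' => h h'.2)]
            exact zero_le
      _ = g z * volume (Iic (infDist z (frontier Ω) / r) ∩ Ioc (0 : ℝ) 1) := by
          rw [lintegral_indicator_const measurableSet_Iic,
            Measure.restrict_apply measurableSet_Iic]
      _ ≤ g z * volume (Ioc (0 : ℝ) (infDist z (frontier Ω) / r)) := by
          gcongr
          exact fun τ hτ => ⟨hτ.2.1, hτ.1⟩
      _ = _ := by
          rw [Real.volume_Ioc, sub_zero, ← mul_assoc, ← ENNReal.ofReal_mul (by positivity),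
            mul_comm, one_div_mul_eq_div]
  · rw [indicator_of_notMem hz]
    refine (lintegral_eq_zero_of_ae_eq_zero (ae_of_all _ fun τ => ?_)).le
    exact indicator_of_notMem (fun h' => hz h'.1) _

section Poincare

variable {N : ℕ} {F : Type*} [NormedAddCommGroup F] [NormedSpace ℝ F] [CompleteSpace F]
  {Ω : Set (Euc N)} {f : Euc N → F} {r d : ℝ}

theorem exists_local_poincare (hΩ : IsOpen Ω) (hbd : Bornology.IsBounded Ω) (hdiam : diam Ω ≤ d)
    (hfr : (frontier Ω).Nonempty) (hf : DifferentiableOn ℝ f Ω) (hr : 0 < r) {p c : Euc N}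
    (hp : p ∈ Ω) (H : ReachesBall r Ω p c) :
    ∃ V, ∫⁻ x in Ω ∩ ball p r, ‖f x - V‖ₑ ≤ ENNReal.ofReal (d * 2 ^ N / r) * weightedGrad Ω f := by
  set U := Ω ∩ ball p r with hU
  set B := ball c r
  set m := volume B with hm
  have hd : 0 ≤ d := diam_nonneg.trans hdiam
  have hm0 : m ≠ 0 := (measure_ball_pos volume c hr).ne'
  have hmt : m ≠ ∞ := measure_ball_lt_top.ne
  have hUm : volume U ≤ m := (measure_mono inter_subset_right).trans
    (by rw [hm, Measure.addHaar_ball_center, Measure.addHaar_ball_center volume c])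
  have hBΩ : B ⊆ Ω := H.ball_subset hr (subset_closure hp)
  have hUms : MeasurableSet U := hΩ.measurableSet.inter measurableSet_ball
  set g : Euc N → ℝ≥0∞ := fun z => ‖fderiv ℝ f z‖ₑ with hg
  have hgm : Measurable g := (measurable_fderiv ℝ f).enorm
  set S := {y : ℝ × Euc N | y.2 ∈ Ω ∧ y.1 * r ≤ infDist y.2 (frontier Ω)} with hS_def
  have hS : MeasurableSet S :=
    (hΩ.measurableSet.preimage measurable_snd).inter
      (measurableSet_le (by fun_prop) (measurable_infDist.comp measurable_snd))
  set k : ℝ → Euc N → ℝ≥0∞ := fun τ z => S.indicator (fun y => g y.2) (τ, z) with hk_def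
  have hk : Measurable (Function.uncurry k) := (hgm.comp measurable_snd).indicator hS
  have hpt : ∀ x ∈ U, ∀ q ∈ B, ‖f q - f x‖ₑ ≤
      ENNReal.ofReal d * ∫⁻ τ in Ioc (0 : ℝ) 1, k τ (x + τ • (q - x)) := by
    intro x hx q hq
    have hx' : x ∈ ball p r ∩ closure Ω := ⟨hx.2, subset_closure hx.1⟩
    have hmem : ∀ τ ∈ Icc (0 : ℝ) 1, x + τ • (q - x) ∈ Ω := by
      intro τ hτ
      rcases hτ.1.eq_or_lt with h | h
      · rw [← h]; simpa using hx.1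
      · exact H.mem hr hx' hq ⟨h, hτ.2⟩
    have := enorm_sub_le_lintegral_segment (f := f) (x := x) (q := q) zero_le_one
      (hf.continuousOn.comp (by fun_prop) hmem)
      (fun τ hτ => hf.differentiableAt (hΩ.mem_nhds (hmem τ ⟨hτ.1.le, hτ.2.le⟩)))
    rw [zero_smul, add_zero] at this
    refine this.trans (mul_le_mul' ?_ ?_)
    · rw [← ofReal_norm, ← dist_eq_norm]
      exact ENNReal.ofReal_le_ofReal ((dist_le_diam_of_mem hbd (hBΩ hq) hx.1).trans hdiam)
    · refine setLIntegral_mono' measurableSet_Ioc fun τ hτ => ?_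
      have hmS : (τ, x + τ • (q - x)) ∈ S :=
        ⟨hmem τ ⟨hτ.1.le, hτ.2⟩, H.le_infDist hΩ hfr hx' hq hτ⟩
      simp only [hk_def, indicator_of_mem hmS, hg, le_refl]
  have hD : ∫⁻ x in U, ∫⁻ q in B, ‖f q - f x‖ₑ ≤
      ENNReal.ofReal (d * 2 ^ N / r) * weightedGrad Ω f * m := by
    calc ∫⁻ x in U, ∫⁻ q in B, ‖f q - f x‖ₑ
        ≤ ∫⁻ x in U, ∫⁻ q in B, ENNReal.ofReal d *
            ∫⁻ τ in Ioc (0 : ℝ) 1, k τ (x + τ • (q - x)) :=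
          setLIntegral_mono' hUms fun x hx => setLIntegral_mono' measurableSet_ball (hpt x hx)
      _ = ENNReal.ofReal d * ∫⁻ x in U, ∫⁻ q in B,
            ∫⁻ τ in Ioc (0 : ℝ) 1, k τ (x + τ • (q - x)) := by
          simp_rw [lintegral_const_mul' _ _ ENNReal.ofReal_ne_top]
      _ ≤ ENNReal.ofReal d * (2 ^ N * m * (ENNReal.ofReal (1 / r) * weightedGrad Ω f)) := by
          gcongr
          refine (lintegral_segments_le hk hUm le_rfl (hUm.trans_lt hmt.lt_top).ne hmt).trans ?_
          gcongr
          exact lintegral_cone_weight_le (F := F) hr hΩ hgm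
      _ = _ := by
          rw [show d * 2 ^ N / r = d * 2 ^ N * (1 / r) by ring, ENNReal.ofReal_mul (by positivity),
            ENNReal.ofReal_mul hd, ENNReal.ofReal_pow (by norm_num), ENNReal.ofReal_ofNat]
          ring
  have hcont : ContinuousOn (fun y : Euc N × Euc N => ‖f y.2 - f y.1‖ₑ) (U ×ˢ B) := by
    refine continuous_enorm.comp_continuousOn (ContinuousOn.sub ?_ ?_)
    · exact hf.continuousOn.comp continuousOn_snd fun y hy => hBΩ hy.2
    · exact hf.continuousOn.comp continuousOn_fst fun y hy => hy.1.1
  have hae : AEMeasurable (Function.uncurry fun x q => ‖f q - f x‖ₑ)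
      ((volume.restrict U).prod (volume.restrict B)) := by
    rw [Measure.prod_restrict]
    exact hcont.aemeasurable (hUms.prod measurableSet_ball)
  rw [lintegral_lintegral_swap hae] at hD
  obtain ⟨q, hq, hle⟩ := exists_le_setLAverage hm0 hmt hae.lintegral_prod_left'
  refine ⟨f q, ?_⟩
  have h2 : ∀ x, ‖f x - f q‖ₑ = ‖f q - f x‖ₑ := fun x => by rw [← enorm_neg, neg_sub]
  simp_rw [h2]
  refine hle.trans ?_
  rw [setLAverage_eq]
  exact ENNReal.div_le_of_le_mul hD

end Poincare

theorem ReachesBall.mono {N : ℕ} {r r' : ℝ} {Ω : Set (Euc N)} {p c : Euc N}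
    (H : ReachesBall r Ω p c) (h : r' ≤ r) : ReachesBall r' Ω p c := fun x hx q hq τ hτ =>
  (ball_subset_ball (mul_le_mul_of_nonneg_left h hτ.1.le)).trans
    (H x ⟨ball_subset_ball h hx.1, hx.2⟩ q (ball_subset_ball h hq) τ hτ)

theorem exists_cover_balls (N : ℕ) (d : ℝ) {η : ℝ} (hη : 0 < η) :
    ∃ K : ℕ, ∀ Ω : Set (Euc N), Bornology.IsBounded Ω → diam Ω ≤ d →
      ∃ P : Fin K → Euc N, Ω ⊆ ⋃ i, ball (P i) η := by
  obtain ⟨t, -, ht, hcov⟩ := (isCompact_closedBall (0 : Euc N) d).finite_cover_balls hη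
  lift t to Finset (Euc N) using ht
  refine ⟨t.card, fun Ω hbd hdiam => ?_⟩
  rcases Ω.eq_empty_or_nonempty with rfl | ⟨p₀, hp₀⟩
  · exact ⟨fun _ => 0, empty_subset _⟩
  refine ⟨fun i => p₀ + (t.equivFin.symm i : Euc N), fun x hx => ?_⟩
  have h1 : x - p₀ ∈ closedBall (0 : Euc N) d := by
    rw [mem_closedBall_zero_iff, ← dist_eq_norm]
    exact (dist_le_diam_of_mem hbd hx hp₀).trans hdiam
  obtain ⟨y, hy, hxy⟩ := mem_iUnion₂.1 (hcov h1)
  refine mem_iUnion.2 ⟨t.equivFin ⟨y, hy⟩, ?_⟩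
  rw [mem_ball, dist_eq_norm] at hxy ⊢
  simpa [sub_sub] using hxy

theorem IsPreconnected.exists_coarse_value {X : Type*} [PseudoMetricSpace X] {Ω : Set X}
    (hΩ : IsPreconnected Ω) {φ : X → ℝ} {η δ L : ℝ} (hη : 0 < η) (hδ : 0 ≤ δ)
    (hφ : ∀ p ∈ Ω, ∀ q ∈ Ω, dist p q < η → φ q ≤ φ p + δ) {p q : X} (hp : p ∈ Ω) (hq : q ∈ Ω)
    (hpL : φ p ≤ L) (hqL : L ≤ φ q) : ∃ x ∈ Ω, L ≤ φ x ∧ φ x ≤ L + δ := by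
  rcases hpL.eq_or_lt with h | h
  · exact ⟨p, hp, h.ge, by linarith⟩
  obtain ⟨y, -, hy1, hy2⟩ := hΩ (thickening (η / 2) {x ∈ Ω | φ x < L})
    (thickening (η / 2) {x ∈ Ω | L ≤ φ x}) isOpen_thickening isOpen_thickening
    (fun x hx => by
      rcases lt_or_ge (φ x) L with h' | h'
      · exact Or.inl (self_subset_thickening (half_pos hη) _ ⟨hx, h'⟩)
      · exact Or.inr (self_subset_thickening (half_pos hη) _ ⟨hx, h'⟩))
    ⟨p, hp, self_subset_thickening (half_pos hη) _ ⟨hp, h⟩⟩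
    ⟨q, hq, self_subset_thickening (half_pos hη) _ ⟨hq, hqL⟩⟩
  obtain ⟨x1, hx1, h1⟩ := mem_thickening_iff.1 hy1
  obtain ⟨x2, hx2, h2⟩ := mem_thickening_iff.1 hy2
  have h3 : dist x1 x2 < η := by
    have := dist_triangle_left x1 x2 y
    linarith
  exact ⟨x2, hx2.1, hx2.2, by linarith [hφ x1 hx1.1 x2 hx2.1 h3, hx1.2]⟩

/-- A function with small oscillation at scale `η` on a connected set covered by `K` balls of
radius `η / 2` has oscillation controlled by `K`. -/
theorem IsPreconnected.norm_sub_le_of_cover {X F : Type*} [PseudoMetricSpace X]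
    [SeminormedAddCommGroup F] {Ω : Set X} (hΩ : IsPreconnected Ω) {V : X → F} {η δ : ℝ}
    (hη : 0 < η) (hδ : 0 ≤ δ)
    (hV : ∀ p ∈ Ω, ∀ q ∈ Ω, dist p q < η → ‖V p - V q‖ ≤ δ) {K : ℕ} {P : Fin K → X}
    (hP : Ω ⊆ ⋃ i, ball (P i) (η / 2)) {p q : X} (hp : p ∈ Ω) (hq : q ∈ Ω) :
    ‖V q - V p‖ ≤ 2 * K * δ := by
  suffices H : ∀ δ' > δ, ‖V q - V p‖ ≤ 2 * K * δ' by
    have ht : Filter.Tendsto (fun x : ℝ => 2 * K * x) (nhdsWithin δ (Ioi δ)) (nhds (2 * K * δ)) :=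
      ((continuous_const.mul continuous_id).tendsto δ).mono_left nhdsWithin_le_nhds
    exact ge_of_tendsto ht (eventually_nhdsWithin_of_forall H)
  intro δ' hδ'
  by_contra! hcon
  set φ : X → ℝ := fun x => ‖V x - V p‖ with hφ
  have hφc : ∀ x ∈ Ω, ∀ y ∈ Ω, dist x y < η → φ y ≤ φ x + δ := by
    intro x hx y hy hxy
    have h1 := hV x hx y hy hxy
    have h2 : ‖V y - V p‖ ≤ ‖V y - V x‖ + ‖V x - V p‖ := norm_sub_le_norm_sub_add_norm_sub _ _ _
    rw [norm_sub_rev] at h1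
    simp only [hφ]; linarith
  have hex : ∀ j : Fin (K + 1), ∃ x ∈ Ω, 2 * (j : ℝ) * δ' ≤ φ x ∧ φ x ≤ 2 * (j : ℝ) * δ' + δ := by
    intro j
    refine hΩ.exists_coarse_value hη hδ hφc hp hq ?_ ?_
    · simp only [hφ, sub_self, norm_zero]
      have : 0 ≤ δ' := hδ.trans hδ'.le
      positivity
    · refine le_trans ?_ hcon.le
      have : (j : ℝ) ≤ K := by exact_mod_cast Nat.lt_succ_iff.1 j.2
      have : 0 ≤ δ' := hδ.trans hδ'.le
      gcongr
  choose x hxΩ hx1 hx2 using hex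
  have hcell : ∀ j, ∃ i, x j ∈ ball (P i) (η / 2) := fun j => mem_iUnion.1 (hP (hxΩ j))
  choose cell hcell using hcell
  obtain ⟨i, j, hij, heq⟩ : ∃ i j, i < j ∧ cell i = cell j := by
    obtain ⟨i, j, hne, heq⟩ := Fintype.exists_ne_map_eq_of_card_lt cell (by simp)
    rcases lt_or_gt_of_ne hne with h | h
    · exact ⟨i, j, h, heq⟩
    · exact ⟨j, i, h, heq.symm⟩
  have hd : dist (x i) (x j) < η := by
    have h1 : dist (x i) (P (cell i)) < η / 2 := hcell i
    have h2 : dist (x j) (P (cell i)) < η / 2 := heq ▸ hcell j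
    linarith [dist_triangle_right (x i) (x j) (P (cell i))]
  have h1 := hφc _ (hxΩ i) _ (hxΩ j) hd
  have h2 : (i : ℝ) + 1 ≤ j := by exact_mod_cast hij
  have h3 : 2 * ((i : ℝ) + 1) * δ' ≤ 2 * (j : ℝ) * δ' := by
    have : 0 ≤ δ' := hδ.trans hδ'.le
    gcongr
  linarith [hx1 j, hx2 i]

universe u

/-- Weighted `L¹` Poincaré inequality, uniform over domains with the cone property. -/
theorem exists_weighted_poincare (N : ℕ) {d r : ℝ} (hd : 0 < d) (hr : 0 < r) :
    ∃ C : ℝ≥0, ∀ Ω : Set (Euc N), IsOpen Ω → IsConnected Ω → Bornology.IsBounded Ω →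
      diam Ω ≤ d → (frontier Ω).Nonempty → (∀ p ∈ closure Ω, ∃ c, ReachesBall r Ω p c) →
      ∀ (F : Type u) [NormedAddCommGroup F] [NormedSpace ℝ F] [CompleteSpace F] (f : Euc N → F),
        DifferentiableOn ℝ f Ω → weightedGrad Ω f ≠ ∞ →
        ∃ V, ∫⁻ x in Ω, ‖f x - V‖ₑ ≤ C * weightedGrad Ω f := by
  obtain ⟨K, hK⟩ := exists_cover_balls N d (η := r / 2 / 2) (by positivity)
  set r₀ : ℝ := r / 2 / (d + r / 2) / 2 * (r / 2) with hr₀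
  have hr₀0 : 0 < r₀ := by positivity
  set m := volume (ball (0 : Euc N) r) with hm
  set m₀ := volume (ball (0 : Euc N) r₀) with hm₀
  have hmt : m ≠ ∞ := measure_ball_lt_top.ne
  have hm₀t : m₀ ≠ ∞ := measure_ball_lt_top.ne
  have hm₀0 : m₀ ≠ 0 := (measure_ball_pos volume _ hr₀0).ne'
  set C₁ := ENNReal.ofReal (d * 2 ^ N / r) with hC₁
  set C : ℝ≥0∞ := K * (C₁ + m * (2 * K * (2 * C₁ / m₀))) with hC
  have hCt : C ≠ ∞ := by
    have : 2 * C₁ / m₀ ≠ ∞ := ENNReal.div_ne_top (by finiteness) hm₀0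
    finiteness
  refine ⟨C.toNNReal, fun Ω hΩ hconn hbd hdiam hfr hreach F _ _ _ f hf hI => ?_⟩
  rw [ENNReal.coe_toNNReal hCt]
  obtain ⟨P, hP⟩ := hK Ω hbd hdiam
  set I := weightedGrad Ω f with hI_def
  have hloc : ∀ p : Euc N, ∃ V, p ∈ Ω → ∫⁻ x in Ω ∩ ball p r, ‖f x - V‖ₑ ≤ C₁ * I := by
    intro p
    by_cases hp : p ∈ Ω
    · obtain ⟨c, hc⟩ := hreach p (subset_closure hp)
      obtain ⟨V, hV⟩ := exists_local_poincare hΩ hbd hdiam hfr hf hr hp hc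
      exact ⟨V, fun _ => hV⟩
    · exact ⟨0, fun h => absurd h hp⟩
  choose V hV using hloc
  have hfm : ∀ W : F, AEMeasurable (fun x => ‖f x - W‖ₑ) (volume.restrict Ω) := fun W =>
    (continuous_enorm.comp_continuousOn (hf.continuousOn.sub continuousOn_const)).aemeasurable
      hΩ.measurableSet
  set δ : ℝ≥0∞ := 2 * C₁ / m₀ * I with hδ
  have hδt : δ ≠ ∞ := by
    have : 2 * C₁ / m₀ ≠ ∞ := ENNReal.div_ne_top (by finiteness) hm₀0
    finiteness
  have hstep : ∀ p ∈ Ω, ∀ q ∈ Ω, dist p q < r / 2 → ‖V p - V q‖ ≤ δ.toReal := by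
    intro p hp q hq hpq
    obtain ⟨c, hc⟩ := hreach p (subset_closure hp)
    obtain ⟨y, hy⟩ := (hc.mono (half_le_self hr.le)).exists_ball_subset (half_pos hr) hd hbd hdiam hp
    have hyp : ball y r₀ ⊆ Ω ∩ ball p r :=
      hy.trans (inter_subset_inter_right _ (ball_subset_ball (half_le_self hr.le)))
    have hyq : ball y r₀ ⊆ Ω ∩ ball q r :=
      hy.trans (inter_subset_inter_right _ (ball_subset_ball' (by linarith)))
    have h1 : ‖V p - V q‖ₑ * m₀ ≤ 2 * C₁ * I := by
      calc ‖V p - V q‖ₑ * m₀ = ∫⁻ x in ball y r₀, ‖V p - V q‖ₑ := by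
            rw [setLIntegral_const, hm₀, Measure.addHaar_ball_center volume y]
        _ ≤ ∫⁻ x in ball y r₀, (‖f x - V p‖ₑ + ‖f x - V q‖ₑ) := by
            refine lintegral_mono fun x => ?_
            have h2 : V p - V q = (f x - V q) - (f x - V p) := by abel
            rw [h2, add_comm]
            exact enorm_sub_le
        _ = (∫⁻ x in ball y r₀, ‖f x - V p‖ₑ) + ∫⁻ x in ball y r₀, ‖f x - V q‖ₑ := by
            refine lintegral_add_left' ((hfm _).mono_measure (Measure.restrict_mono ?_ le_rfl)) _
            exact hyp.trans inter_subset_left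
        _ ≤ C₁ * I + C₁ * I := add_le_add
            ((lintegral_mono_set hyp).trans (hV p hp)) ((lintegral_mono_set hyq).trans (hV q hq))
        _ = 2 * C₁ * I := by ring
    rw [← toReal_enorm]
    refine ENNReal.toReal_mono hδt ?_
    rw [hδ, ← ENNReal.mul_div_right_comm]
    exact (ENNReal.le_div_iff_mul_le (Or.inl hm₀0) (Or.inl hm₀t)).2 h1
  obtain ⟨p₀, hp₀⟩ := hconn.nonempty
  have hosc : ∀ q ∈ Ω, ‖V q - V p₀‖ₑ ≤ 2 * K * δ := by
    intro q hq
    have h := hconn.isPreconnected.norm_sub_le_of_cover (half_pos hr) ENNReal.toReal_nonneg hstep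
      hP hp₀ hq
    rw [← ofReal_norm]
    refine (ENNReal.ofReal_le_ofReal h).trans ?_
    rw [ENNReal.ofReal_mul (by positivity), ENNReal.ofReal_mul (by positivity),
      ENNReal.ofReal_toReal hδt, ENNReal.ofReal_natCast, ENNReal.ofReal_ofNat]
  refine ⟨V p₀, ?_⟩
  have hcell : ∀ i, ∫⁻ x in Ω ∩ ball (P i) (r / 2 / 2), ‖f x - V p₀‖ₑ ≤
      C₁ * I + m * (2 * K * δ) := by
    intro i
    rcases (Ω ∩ ball (P i) (r / 2 / 2)).eq_empty_or_nonempty with h | ⟨p, hp, hpi⟩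
    · rw [h]; simp
    have hsub : Ω ∩ ball (P i) (r / 2 / 2) ⊆ Ω ∩ ball p r := by
      refine inter_subset_inter_right _ (ball_subset_ball' ?_)
      rw [mem_ball, dist_comm] at hpi
      linarith
    refine (lintegral_mono_set hsub).trans ?_
    calc ∫⁻ x in Ω ∩ ball p r, ‖f x - V p₀‖ₑ
        ≤ ∫⁻ x in Ω ∩ ball p r, (‖f x - V p‖ₑ + 2 * K * δ) := by
          refine lintegral_mono fun x => ?_
          have h2 : f x - V p₀ = (f x - V p) + (V p - V p₀) := by abel
          rw [h2]
          exact (enorm_add_le _ _).trans (by gcongr; exact hosc p hp)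
      _ = (∫⁻ x in Ω ∩ ball p r, ‖f x - V p‖ₑ) + 2 * K * δ * volume (Ω ∩ ball p r) := by
          rw [lintegral_add_right _ measurable_const, setLIntegral_const]
      _ ≤ C₁ * I + 2 * K * δ * m := by
          gcongr
          · exact hV p hp
          · refine (measure_mono inter_subset_right).trans ?_
            rw [hm, Measure.addHaar_ball_center volume p]
      _ = _ := by ring
  calc ∫⁻ x in Ω, ‖f x - V p₀‖ₑ
      ≤ ∫⁻ x in ⋃ i, Ω ∩ ball (P i) (r / 2 / 2), ‖f x - V p₀‖ₑ := by
        refine lintegral_mono_set ?_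
        rw [← inter_iUnion]
        exact subset_inter le_rfl hP
    _ ≤ ∑' i, ∫⁻ x in Ω ∩ ball (P i) (r / 2 / 2), ‖f x - V p₀‖ₑ := lintegral_iUnion_le _ _
    _ = ∑ i, ∫⁻ x in Ω ∩ ball (P i) (r / 2 / 2), ‖f x - V p₀‖ₑ := tsum_fintype _
    _ ≤ ∑ _i : Fin K, (C₁ * I + m * (2 * K * δ)) := Finset.sum_le_sum fun i _ => hcell i
    _ = C * I := by
        rw [Finset.sum_const, Finset.card_univ, Fintype.card_fin, nsmul_eq_mul, hC, hδ]
        ring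

theorem lintegral_sq_le {α : Type*} [MeasurableSpace α] {μ : Measure α} {s : Set α}
    {w : α → ℝ≥0∞} (hw : AEMeasurable w (μ.restrict s)) :
    (∫⁻ x in s, w x ∂μ) ^ 2 ≤ μ s * ∫⁻ x in s, w x ^ 2 ∂μ := by
  have h := ENNReal.lintegral_mul_le_Lp_mul_Lq (μ.restrict s) Real.HolderConjugate.two_two
    (aemeasurable_const (b := (1 : ℝ≥0∞))) hw
  simp only [Pi.mul_apply, one_mul, ENNReal.rpow_two, lintegral_const,
    Measure.restrict_apply_univ] at h
  refine (pow_le_pow_left' h 2).trans_eq ?_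
  rw [mul_pow]
  congr 1 <;>
  · rw [← ENNReal.rpow_natCast, ← ENNReal.rpow_mul]
    norm_num

section Boundary

variable {N : ℕ} {Ω : Set (Euc N)} {r d A : ℝ} {x c : Euc N}

theorem lintegral_ball_fderiv_le {F : Type*} [NormedAddCommGroup F] [NormedSpace ℝ F]
    [CompleteSpace F] {v : Euc N → F} (hΩ : IsOpen Ω) (hfr : (frontier Ω).Nonempty) (hr : 0 < r)
    (hx : x ∈ closure Ω) (H : ReachesBall r Ω x c) (hA : 0 ≤ A)
    (hW : ∫⁻ z in Ω, (ENNReal.ofReal (infDist z (frontier Ω)) * ‖fderiv ℝ v z‖ₑ) ^ 2 ≤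
      ENNReal.ofReal (A ^ 2)) {σ : ℝ} (hσ : σ ∈ Ioc (0 : ℝ) 1) :
    ∫⁻ q in ball c r, ‖fderiv ℝ v (x + σ • (q - x))‖ₑ ≤
      ENNReal.ofReal (√(volume.real (ball c r)) / r * A * σ ^ (-(N : ℝ) / 2 - 1)) := by
  have hσ0 : 0 < σ := hσ.1
  have hx' : x ∈ ball x r ∩ closure Ω := ⟨mem_ball_self hr, hx⟩
  have hgm : Measurable fun z => ‖fderiv ℝ v z‖ₑ := (measurable_fderiv ℝ v).enorm
  set w : Euc N → ℝ≥0∞ := fun z => ENNReal.ofReal (infDist z (frontier Ω)) * ‖fderiv ℝ v z‖ₑ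
    with hw
  have hwm : Measurable w := by fun_prop
  have hW' : ∫⁻ z, Ω.indicator (fun z => w z ^ 2) z ≤ ENNReal.ofReal (A ^ 2) := by
    rwa [lintegral_indicator hΩ.measurableSet]
  have hm : volume (ball c r) = ENNReal.ofReal (volume.real (ball c r)) :=
    (ofReal_measureReal measure_ball_lt_top.ne).symm
  rw [← ENNReal.pow_le_pow_left_iff two_ne_zero]
  have hgm' : Measurable fun q => ‖fderiv ℝ v (x + σ • (q - x))‖ₑ := hgm.comp (by fun_prop)
  refine (lintegral_sq_le hgm'.aemeasurable).trans ?_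
  calc volume (ball c r) * ∫⁻ q in ball c r, ‖fderiv ℝ v (x + σ • (q - x))‖ₑ ^ 2
      ≤ volume (ball c r) * ∫⁻ q in ball c r, ENNReal.ofReal ((σ * r)⁻¹ ^ 2) *
          Ω.indicator (fun z => w z ^ 2) (x + σ • (q - x)) := by
        refine mul_le_mul' le_rfl (setLIntegral_mono' measurableSet_ball fun q hq => ?_)
        rw [indicator_of_mem (H.mem hr hx' hq hσ), hw, ENNReal.ofReal_pow (by positivity),
          ← mul_pow, ← mul_assoc, ← ENNReal.ofReal_mul (by positivity)]
        have h1 : 1 ≤ (σ * r)⁻¹ * infDist (x + σ • (q - x)) (frontier Ω) := by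
          rw [inv_mul_eq_div, one_le_div (by positivity)]
          exact H.le_infDist hΩ hfr hx' hq hσ
        refine pow_le_pow_left' (le_mul_of_one_le_left' ?_) 2
        rwa [ENNReal.one_le_ofReal]
    _ ≤ volume (ball c r) * (ENNReal.ofReal ((σ * r)⁻¹ ^ 2) *
          (ENNReal.ofReal ((σ ^ N)⁻¹) * ENNReal.ofReal (A ^ 2))) := by
        rw [lintegral_const_mul' _ _ ENNReal.ofReal_ne_top]
        gcongr
        refine (setLIntegral_le_lintegral _ _).trans ?_
        rw [lintegral_comp_homothety ((hwm.pow_const 2).indicator hΩ.measurableSet) hσ0]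
        gcongr
    _ = _ := by
        rw [hm, ← ENNReal.ofReal_pow (by positivity), ← ENNReal.ofReal_mul (by positivity),
          ← ENNReal.ofReal_mul (by positivity), ← ENNReal.ofReal_mul (by positivity)]
        congr 1
        have h2 : (σ ^ (-(N : ℝ) / 2 - 1)) ^ 2 = (σ ^ N)⁻¹ * (σ ^ 2)⁻¹ := by
          rw [← Real.rpow_natCast (σ ^ (-(N : ℝ) / 2 - 1)) 2, ← Real.rpow_mul hσ0.le,
            ← Real.rpow_natCast σ N, ← Real.rpow_natCast σ 2, ← Real.rpow_neg hσ0.le,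
            ← Real.rpow_neg hσ0.le, ← Real.rpow_add hσ0]
          congr 1; push_cast; ring
        rw [mul_pow, mul_pow, div_pow, h2, Real.sq_sqrt (by positivity)]
        field_simp

theorem lintegral_Ioc_rpow_le (hN : 2 ≤ N) {τ : ℝ} (hτ : τ ∈ Ioc (0 : ℝ) 1) {B : ℝ} (hB : 0 ≤ B) :
    ∫⁻ σ in Ioc τ 1, ENNReal.ofReal (B * σ ^ (-(N : ℝ) / 2 - 1)) ≤
      ENNReal.ofReal (B * τ ^ (-(N : ℝ) / 2)) := by
  have hN' : (2 : ℝ) ≤ N := by exact_mod_cast hN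
  have h0 : (0 : ℝ) ∉ uIcc τ 1 := by
    rw [uIcc_of_le hτ.2]; exact fun h => absurd hτ.1 (not_lt.2 h.1)
  have hinteg : IntervalIntegrable (fun σ : ℝ => B * σ ^ (-(N : ℝ) / 2 - 1)) volume τ 1 :=
    (intervalIntegral.intervalIntegrable_rpow (Or.inr h0)).const_mul B
  rw [← ofReal_integral_eq_lintegral_ofReal]
  · refine ENNReal.ofReal_le_ofReal ?_
    rw [← intervalIntegral.integral_of_le hτ.2, intervalIntegral.integral_const_mul,
      integral_rpow (Or.inr ⟨by linarith, h0⟩)]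
    refine mul_le_mul_of_nonneg_left ?_ hB
    have h1 : -(N : ℝ) / 2 - 1 + 1 = -(N / 2) := by ring
    have h2 : -(N : ℝ) / 2 = -(N / 2) := by ring
    have h3 : 0 < τ ^ (-((N : ℝ) / 2)) := Real.rpow_pos_of_pos hτ.1 _
    rw [h1, h2, Real.one_rpow, div_neg, ← neg_div, neg_sub, div_le_iff₀ (by linarith)]
    nlinarith
  · exact (intervalIntegrable_iff_integrableOn_Ioc_of_le hτ.2).1 hinteg
  · filter_upwards [self_mem_ae_restrict measurableSet_Ioc] with σ hσ
    have : 0 < σ := hτ.1.trans hσ.1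
    positivity

theorem lintegral_ball_segment_le {F : Type*} [NormedAddCommGroup F] [NormedSpace ℝ F]
    [CompleteSpace F] {v : Euc N → F} (hN : 2 ≤ N) (hΩ : IsOpen Ω) (hbd : Bornology.IsBounded Ω)
    (hdiam : diam Ω ≤ d)
    (hfr : (frontier Ω).Nonempty) (hr : 0 < r) (hv : DifferentiableOn ℝ v Ω)
    (hx : x ∈ closure Ω) (H : ReachesBall r Ω x c) (hA : 0 ≤ A)
    (hW : ∫⁻ z in Ω, (ENNReal.ofReal (infDist z (frontier Ω)) * ‖fderiv ℝ v z‖ₑ) ^ 2 ≤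
      ENNReal.ofReal (A ^ 2)) {b : ℝ} (hb : 0 ≤ b)
    (hvA : ∫⁻ z in Ω, ‖v z‖ₑ ≤ ENNReal.ofReal (b * A)) {τ : ℝ} (hτ : τ ∈ Ioc (0 : ℝ) 1) :
    ∫⁻ q in ball c r, ‖v (x + τ • (q - x))‖ₑ ≤
      ENNReal.ofReal ((b + d * √(volume.real (ball c r)) / r) * A * τ ^ (-(N : ℝ) / 2)) := by
  have hd : 0 ≤ d := diam_nonneg.trans hdiam
  have hx' : x ∈ ball x r ∩ closure Ω := ⟨mem_ball_self hr, hx⟩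
  have hBΩ : ball c r ⊆ Ω := H.ball_subset hr hx
  have hgm : Measurable fun z => ‖fderiv ℝ v z‖ₑ := (measurable_fderiv ℝ v).enorm
  have hmem : ∀ q ∈ ball c r, ∀ σ ∈ Icc τ 1, x + σ • (q - x) ∈ Ω := fun q hq σ hσ =>
    H.mem hr hx' hq ⟨hτ.1.trans_le hσ.1, hσ.2⟩
  have hgm2 : Measurable (Function.uncurry fun (q : Euc N) (σ : ℝ) =>
      ‖fderiv ℝ v (x + σ • (q - x))‖ₑ) :=
    hgm.comp (by fun_prop : Measurable fun y : Euc N × ℝ => x + y.2 • (y.1 - x))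
  have hgm3 : Measurable fun q : Euc N => ∫⁻ σ in Ioc τ 1, ‖fderiv ℝ v (x + σ • (q - x))‖ₑ :=
    hgm2.lintegral_prod_right'
  have hpt : ∀ q ∈ ball c r, ‖v (x + τ • (q - x))‖ₑ ≤
      ‖v q‖ₑ + ENNReal.ofReal d * ∫⁻ σ in Ioc τ 1, ‖fderiv ℝ v (x + σ • (q - x))‖ₑ := by
    intro q hq
    have h1 := enorm_sub_le_lintegral_segment (f := v) (x := x) (q := q) hτ.2
      (hv.continuousOn.comp (by fun_prop) (hmem q hq))
      (fun σ hσ => hv.differentiableAt (hΩ.mem_nhds (hmem q hq σ ⟨hσ.1.le, hσ.2.le⟩)))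
    have h2 : v (x + τ • (q - x)) = v q - (v q - v (x + τ • (q - x))) := by abel
    rw [h2]
    refine enorm_sub_le.trans (add_le_add le_rfl (h1.trans (mul_le_mul' ?_ le_rfl)))
    rw [← ofReal_norm, ← dist_eq_norm, ← diam_closure] at *
    exact ENNReal.ofReal_le_ofReal
      ((dist_le_diam_of_mem hbd.closure (subset_closure (hBΩ hq)) hx).trans hdiam)
  have hA' : 0 ≤ √(volume.real (ball c r)) / r * A := by positivity
  have h1τ : 1 ≤ τ ^ (-(N : ℝ) / 2) := by
    refine Real.one_le_rpow_of_pos_of_le_one_of_nonpos hτ.1 hτ.2 ?_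
    have : (0 : ℝ) ≤ N := N.cast_nonneg
    linarith
  calc ∫⁻ q in ball c r, ‖v (x + τ • (q - x))‖ₑ
      ≤ ∫⁻ q in ball c r, (‖v q‖ₑ +
          ENNReal.ofReal d * ∫⁻ σ in Ioc τ 1, ‖fderiv ℝ v (x + σ • (q - x))‖ₑ) :=
        setLIntegral_mono' measurableSet_ball hpt
    _ = (∫⁻ q in ball c r, ‖v q‖ₑ) + ENNReal.ofReal d *
          ∫⁻ σ in Ioc τ 1, ∫⁻ q in ball c r, ‖fderiv ℝ v (x + σ • (q - x))‖ₑ := by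
        rw [lintegral_add_right _ (hgm3.const_mul _),
          lintegral_const_mul' _ _ ENNReal.ofReal_ne_top,
          lintegral_lintegral_swap hgm2.aemeasurable]
    _ ≤ ENNReal.ofReal (b * A) + ENNReal.ofReal d *
          ENNReal.ofReal (√(volume.real (ball c r)) / r * A * τ ^ (-(N : ℝ) / 2)) := by
        gcongr
        · exact (lintegral_mono_set hBΩ).trans hvA
        · refine (setLIntegral_mono' measurableSet_Ioc fun σ hσ => ?_).trans
            (lintegral_Ioc_rpow_le hN hτ hA')
          exact lintegral_ball_fderiv_le hΩ hfr hr hx H hA hW ⟨hτ.1.trans hσ.1, hσ.2⟩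
    _ ≤ _ := by
        rw [← ENNReal.ofReal_mul hd, ← ENNReal.ofReal_add (by positivity) (by positivity)]
        refine ENNReal.ofReal_le_ofReal ?_
        have : b * A ≤ b * A * τ ^ (-(N : ℝ) / 2) := le_mul_of_one_le_right (by positivity) h1τ
        have e : (b + d * √(volume.real (ball c r)) / r) * A * τ ^ (-(N : ℝ) / 2) =
          b * A * τ ^ (-(N : ℝ) / 2) +
            d * (√(volume.real (ball c r)) / r * A * τ ^ (-(N : ℝ) / 2)) := by ring
        rw [e]
        gcongr

theorem enorm_boundary_sub_le {h : Euc N → ℝ} {M : ℝ} (hN : 2 ≤ N) (hΩ : IsOpen Ω)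
    (hbd : Bornology.IsBounded Ω) (hdiam : diam Ω ≤ d)
    (hfr : (frontier Ω).Nonempty) (hr : 0 < r) (hc : ContinuousOn h (closure Ω))
    (hh : DifferentiableOn ℝ h Ω) (hv : DifferentiableOn ℝ (fderiv ℝ h) Ω)
    (hx : x ∈ closure Ω) (H : ReachesBall r Ω x c) (hA : 0 ≤ A)
    (hW : ∫⁻ z in Ω, (ENNReal.ofReal (infDist z (frontier Ω)) * ‖fderiv ℝ (fderiv ℝ h) z‖ₑ) ^ 2 ≤
      ENNReal.ofReal (A ^ 2)) {b : ℝ} (hb : 0 ≤ b)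
    (hvA : ∫⁻ z in Ω, ‖fderiv ℝ h z‖ₑ ≤ ENNReal.ofReal (b * A))
    (hM : ∀ z ∈ Ω, ‖fderiv ℝ h z‖ ≤ M) (V : ℝ) :
    ‖h x - V‖ₑ * volume (ball c r) ≤ (∫⁻ z in Ω, ‖h z - V‖ₑ) +
      ENNReal.ofReal d * ∫⁻ τ in Ioc (0 : ℝ) 1, ENNReal.ofReal
        ((volume.real (ball c r) + (b + d * √(volume.real (ball c r)) / r)) *
          min M (A * τ ^ (-(N : ℝ) / 2))) := by
  have hd : 0 ≤ d := diam_nonneg.trans hdiam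
  have hx' : x ∈ ball x r ∩ closure Ω := ⟨mem_ball_self hr, hx⟩
  have hBΩ : ball c r ⊆ Ω := H.ball_subset hr hx
  have hgm : Measurable fun z => ‖fderiv ℝ h z‖ₑ := (measurable_fderiv ℝ h).enorm
  have hM0 : 0 ≤ M := (norm_nonneg _).trans (hM c (hBΩ (mem_ball_self hr)))
  have hmem : ∀ q ∈ ball c r, ∀ σ ∈ Icc (0 : ℝ) 1, x + σ • (q - x) ∈ closure Ω := by
    intro q hq σ hσ
    rcases hσ.1.eq_or_lt with h0 | h0
    · rw [← h0]; simpa using hx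
    · exact subset_closure (H.mem hr hx' hq ⟨h0, hσ.2⟩)
  have hgm2 : Measurable (Function.uncurry fun (q : Euc N) (σ : ℝ) =>
      ‖fderiv ℝ h (x + σ • (q - x))‖ₑ) :=
    hgm.comp (by fun_prop : Measurable fun y : Euc N × ℝ => x + y.2 • (y.1 - x))
  have hgm3 : Measurable fun q : Euc N => ∫⁻ σ in Ioc (0 : ℝ) 1, ‖fderiv ℝ h (x + σ • (q - x))‖ₑ :=
    hgm2.lintegral_prod_right'
  have hpt : ∀ q ∈ ball c r, ‖h x - V‖ₑ ≤
      ‖h q - V‖ₑ + ENNReal.ofReal d * ∫⁻ σ in Ioc (0 : ℝ) 1, ‖fderiv ℝ h (x + σ • (q - x))‖ₑ := by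
    intro q hq
    have h1 := enorm_sub_le_lintegral_segment (f := h) (x := x) (q := q) zero_le_one
      (hc.comp (by fun_prop) (hmem q hq))
      (fun σ hσ => hh.differentiableAt (hΩ.mem_nhds (H.mem hr hx' hq ⟨hσ.1, hσ.2.le⟩)))
    rw [zero_smul, add_zero] at h1
    have h2 : h x - V = (h q - V) - (h q - h x) := by ring
    rw [h2]
    refine enorm_sub_le.trans (add_le_add le_rfl (h1.trans (mul_le_mul' ?_ le_rfl)))
    rw [← ofReal_norm, ← dist_eq_norm, ← diam_closure] at *
    exact ENNReal.ofReal_le_ofReal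
      ((dist_le_diam_of_mem hbd.closure (subset_closure (hBΩ hq)) hx).trans hdiam)
  calc ‖h x - V‖ₑ * volume (ball c r) = ∫⁻ q in ball c r, ‖h x - V‖ₑ := by
        rw [setLIntegral_const]
    _ ≤ ∫⁻ q in ball c r, (‖h q - V‖ₑ +
          ENNReal.ofReal d * ∫⁻ σ in Ioc (0 : ℝ) 1, ‖fderiv ℝ h (x + σ • (q - x))‖ₑ) :=
        setLIntegral_mono' measurableSet_ball hpt
    _ = (∫⁻ q in ball c r, ‖h q - V‖ₑ) + ENNReal.ofReal d *
          ∫⁻ σ in Ioc (0 : ℝ) 1, ∫⁻ q in ball c r, ‖fderiv ℝ h (x + σ • (q - x))‖ₑ := by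
        rw [lintegral_add_right _ (hgm3.const_mul _),
          lintegral_const_mul' _ _ ENNReal.ofReal_ne_top,
          lintegral_lintegral_swap hgm2.aemeasurable]
    _ ≤ _ := by
        gcongr 1
        · exact lintegral_mono_set hBΩ
        gcongr 1
        refine setLIntegral_mono' measurableSet_Ioc fun τ hτ => ?_
        have hτ0 : 0 < τ := hτ.1
        have hb0 : 0 ≤ b + d * √(volume.real (ball c r)) / r := by positivity
        have hAτ : 0 ≤ A * τ ^ (-(N : ℝ) / 2) := by positivity
        rw [mul_min_of_nonneg _ _ (by positivity)]
        rcases min_choice ((volume.real (ball c r) + (b + d * √(volume.real (ball c r)) / r)) * M)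
          ((volume.real (ball c r) + (b + d * √(volume.real (ball c r)) / r)) *
            (A * τ ^ (-(N : ℝ) / 2))) with e | e <;> rw [e]
        · calc ∫⁻ q in ball c r, ‖fderiv ℝ h (x + τ • (q - x))‖ₑ
              ≤ ∫⁻ q in ball c r, ENNReal.ofReal M := by
                refine setLIntegral_mono' measurableSet_ball fun q hq => ?_
                rw [← ofReal_norm]
                exact ENNReal.ofReal_le_ofReal (hM _ (H.mem hr hx' hq hτ))
            _ = ENNReal.ofReal (volume.real (ball c r) * M) := by
                rw [setLIntegral_const, ← ofReal_measureReal measure_ball_lt_top.ne,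
                  ← ENNReal.ofReal_mul hM0, mul_comm]
            _ ≤ _ := ENNReal.ofReal_le_ofReal (by
                rw [add_mul]; exact le_add_of_nonneg_right (by positivity))
        · refine (lintegral_ball_segment_le hN hΩ hbd hdiam hfr hr hv hx H hA hW hb hvA hτ).trans
            (ENNReal.ofReal_le_ofReal ?_)
          rw [mul_assoc, add_mul (volume.real (ball c r))]
          exact le_add_of_nonneg_left (by positivity)

end Boundary

section OneDimensional

variable {A M : ℝ}

theorem lintegral_min_rpow_le (hM : 0 ≤ M) (hA : 0 ≤ A) (p : ℝ) {t : ℝ} (ht : t ∈ Ioc (0 : ℝ) 1) :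
    ∫⁻ τ in Ioc (0 : ℝ) 1, ENNReal.ofReal (min M (A * τ ^ p)) ≤
      ENNReal.ofReal (t * M + A * ∫ τ in t..1, τ ^ p) := by
  have h0 : (0 : ℝ) ∉ uIcc t 1 := by
    rw [uIcc_of_le ht.2]; exact fun h => absurd ht.1 (not_lt.2 h.1)
  have hinteg : IntervalIntegrable (fun τ : ℝ => A * τ ^ p) volume t 1 :=
    (intervalIntegral.intervalIntegrable_rpow (Or.inr h0)).const_mul A
  have hnn : 0 ≤ ∫ τ in t..1, τ ^ p :=
    intervalIntegral.integral_nonneg ht.2 fun τ hτ => Real.rpow_nonneg (ht.1.le.trans hτ.1) p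
  rw [← Ioc_union_Ioc_eq_Ioc ht.1.le ht.2,
    lintegral_union measurableSet_Ioc (Ioc_disjoint_Ioc_of_le le_rfl),
    ENNReal.ofReal_add (mul_nonneg ht.1.le hM) (mul_nonneg hA hnn)]
  refine add_le_add ?_ ?_
  · calc ∫⁻ τ in Ioc 0 t, ENNReal.ofReal (min M (A * τ ^ p))
        ≤ ∫⁻ τ in Ioc 0 t, ENNReal.ofReal M := by gcongr; exact min_le_left _ _
      _ = _ := by
        rw [setLIntegral_const, Real.volume_Ioc, ← ENNReal.ofReal_mul hM, sub_zero, mul_comm]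
  · calc ∫⁻ τ in Ioc t 1, ENNReal.ofReal (min M (A * τ ^ p))
        ≤ ∫⁻ τ in Ioc t 1, ENNReal.ofReal (A * τ ^ p) := by gcongr; exact min_le_right _ _
      _ = _ := by
        rw [← ofReal_integral_eq_lintegral_ofReal, ← intervalIntegral.integral_of_le ht.2,
          intervalIntegral.integral_const_mul]
        · exact (intervalIntegrable_iff_integrableOn_Ioc_of_le ht.2).1 hinteg
        · filter_upwards [self_mem_ae_restrict measurableSet_Ioc] with τ hτ
          have : 0 < τ := ht.1.trans hτ.1
          positivity

theorem lintegral_min_rpow_le_self (hM : 0 ≤ M) (hA : 0 ≤ A) (p : ℝ) :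
    ∫⁻ τ in Ioc (0 : ℝ) 1, ENNReal.ofReal (min M (A * τ ^ p)) ≤ ENNReal.ofReal M := by
  simpa using lintegral_min_rpow_le hM hA p (t := 1) (by simp)

theorem lintegral_min_inv_le (hM : 0 ≤ M) (hA : 0 ≤ A) :
    ∫⁻ τ in Ioc (0 : ℝ) 1, ENNReal.ofReal (min M (A * τ ^ (-1 : ℝ))) ≤
      ENNReal.ofReal (A * max (Real.log (Real.exp 1 * M / A)) 1) := by
  rcases le_or_gt M A with h | h
  · refine (lintegral_min_rpow_le_self hM hA _).trans (ENNReal.ofReal_le_ofReal ?_)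
    exact h.trans (le_mul_of_one_le_right hA (le_max_right _ _))
  rcases hA.eq_or_lt with rfl | hA0
  · simp [min_eq_right hM]
  have hM0 := hA0.trans h
  refine (lintegral_min_rpow_le hM hA _ (t := A / M)
    ⟨by positivity, (div_le_one hM0).2 h.le⟩).trans (ENNReal.ofReal_le_ofReal ?_)
  simp only [Real.rpow_neg_one]
  rw [integral_inv_of_pos (by positivity) one_pos, div_mul_cancel₀ _ hM0.ne', one_div_div]
  calc A + A * Real.log (M / A) = A * Real.log (Real.exp 1 * M / A) := by
        rw [mul_div_assoc, Real.log_mul (by positivity) (by positivity), Real.log_exp]; ring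
    _ ≤ _ := by gcongr; exact le_max_left _ _

theorem lintegral_min_rpow_neg_half_le {N : ℕ} (hN : 3 ≤ N) (hM : 0 ≤ M) (hA : 0 ≤ A) :
    ∫⁻ τ in Ioc (0 : ℝ) 1, ENNReal.ofReal (min M (A * τ ^ (-(N : ℝ) / 2))) ≤
      ENNReal.ofReal (3 * (M ^ (((N : ℝ) - 2) / N) * A ^ ((2 : ℝ) / N))) := by
  have hN' : (3 : ℝ) ≤ N := by exact_mod_cast hN
  have hN0 : (0 : ℝ) < N := by linarith
  have he : ((N : ℝ) - 2) / N + 2 / N = 1 := by field_simp; ring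
  rcases hM.eq_or_lt with rfl | hM0
  · refine (lintegral_min_rpow_le_self le_rfl hA _).trans ?_
    simp
  rcases le_or_gt M A with h | h
  · refine (lintegral_min_rpow_le_self hM hA _).trans (ENNReal.ofReal_le_ofReal ?_)
    calc M = M ^ (((N : ℝ) - 2) / N) * M ^ ((2 : ℝ) / N) := by
          rw [← Real.rpow_add hM0, he, Real.rpow_one]
      _ ≤ M ^ (((N : ℝ) - 2) / N) * A ^ ((2 : ℝ) / N) := by gcongr
      _ ≤ _ := le_mul_of_one_le_left (by positivity) (by norm_num)
  rcases hA.eq_or_lt with rfl | hA0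
  · simp [min_eq_right hM]
  set t : ℝ := (A / M) ^ ((2 : ℝ) / N) with ht
  have ht0 : 0 < t := by positivity
  have ht1 : t ≤ 1 := Real.rpow_le_one (by positivity) ((div_le_one hM0).2 h.le) (by positivity)
  refine (lintegral_min_rpow_le hM hA _ ⟨ht0, ht1⟩).trans (ENNReal.ofReal_le_ofReal ?_)
  have h0 : (0 : ℝ) ∉ uIcc t 1 := by
    rw [uIcc_of_le ht1]; exact fun h => absurd ht0 (not_lt.2 h.1)
  have h1 : t * M = M ^ (((N : ℝ) - 2) / N) * A ^ ((2 : ℝ) / N) := by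
    have : M = M ^ (((N : ℝ) - 2) / N) * M ^ ((2 : ℝ) / N) := by
      rw [← Real.rpow_add hM0, he, Real.rpow_one]
    rw [ht, Real.div_rpow hA hM, div_mul_eq_mul_div, div_eq_iff (by positivity)]
    conv_lhs => rw [this]
    ring
  have h2 : t ^ (-(N : ℝ) / 2) = M / A := by
    rw [ht, ← Real.rpow_mul (by positivity), show (2 : ℝ) / N * (-N / 2) = -1 by field_simp,
      Real.rpow_neg_one, inv_div]
  have h3 : A * t ^ (-(N : ℝ) / 2 + 1) = t * M := by
    rw [Real.rpow_add_one ht0.ne', h2]; field_simp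
  rw [integral_rpow (Or.inr ⟨by linarith, h0⟩), Real.one_rpow, ← h1]
  have h4 : (1 - t ^ (-(N : ℝ) / 2 + 1)) / (-(N : ℝ) / 2 + 1) ≤ 2 * t ^ (-(N : ℝ) / 2 + 1) := by
    have : 0 < t ^ (-(N : ℝ) / 2 + 1) := by positivity
    rw [div_le_iff_of_neg (by linarith)]
    nlinarith
  calc t * M + A * ((1 - t ^ (-(N : ℝ) / 2 + 1)) / (-(N : ℝ) / 2 + 1))
      ≤ t * M + A * (2 * t ^ (-(N : ℝ) / 2 + 1)) := by gcongr
    _ = 3 * (t * M) := by rw [mul_left_comm, h3]; ring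

end OneDimensional

section MaximumPrinciple

variable {N : ℕ} {Ω : Set (Euc N)} {u : Euc N → ℝ} {x : Euc N}

theorem differentiableAt_fderiv_of_contDiffOn {F : Type*} [NormedAddCommGroup F]
    [NormedSpace ℝ F] {u : Euc N → F} (hΩ : IsOpen Ω) (hu : ContDiffOn ℝ 2 u Ω) (hx : x ∈ Ω) :
    DifferentiableAt ℝ (fderiv ℝ u) x :=
  ((hu.contDiffAt (hΩ.mem_nhds hx)).fderiv_right (m := 1) (by norm_num)).differentiableAt
    one_ne_zero

theorem hessEntry_eq (h : DifferentiableAt ℝ (fderiv ℝ u) x) (i j : Fin N) :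
    hessEntry u x i j = fderiv ℝ (fderiv ℝ u) x (EuclideanSpace.single i 1)
      (EuclideanSpace.single j 1) := by
  rw [hessEntry, fderiv_clm_apply h (differentiableAt_const _)]
  simp

theorem hessEntry_self_nonpos_of_isLocalMax (hΩ : IsOpen Ω) (hu : ContDiffOn ℝ 2 u Ω) (hx : x ∈ Ω)
    (hmax : IsLocalMax u x) (i : Fin N) : hessEntry u x i i ≤ 0 := by
  by_contra! hpos
  set e : Euc N := EuclideanSpace.single i 1
  have hline : ∀ t : ℝ, HasDerivAt (fun t : ℝ => x + t • e) e t := fun t => by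
    simpa using ((hasDerivAt_id t).smul_const e).const_add x
  have hcont : ContinuousAt (fun t : ℝ => x + t • e) 0 := (hline 0).continuousAt
  have htend : Filter.Tendsto (fun t : ℝ => x + t • e) (nhds 0) (nhds x) := by
    simpa [ContinuousAt] using hcont
  have hd1 : deriv (fun t : ℝ => u (x + t • e)) =ᶠ[nhds 0] fun t => fderiv ℝ u (x + t • e) e := by
    filter_upwards [htend (hΩ.mem_nhds hx)] with t ht
    exact (((hu.differentiableOn two_ne_zero).differentiableAt
      (hΩ.mem_nhds ht)).hasFDerivAt.comp_hasDerivAt t (hline t)).deriv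
  have hd2 : deriv (deriv fun t : ℝ => u (x + t • e)) 0 = hessEntry u x i i := by
    rw [hd1.deriv_eq]
    have h1 : HasFDerivAt (fun y => fderiv ℝ u y e) (fderiv ℝ (fun y => fderiv ℝ u y e) x)
        (x + (0 : ℝ) • e) := by
      simpa using ((differentiableAt_fderiv_of_contDiffOn hΩ hu hx).clm_apply
        (differentiableAt_const e)).hasFDerivAt
    exact (h1.comp_hasDerivAt 0 (hline 0)).deriv
  have hmax' : IsLocalMax (fun t : ℝ => u (x + t • e)) 0 := by
    have := htend.eventually hmax
    simpa [IsLocalMax, IsMaxFilter] using this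
  have hc0 : ContinuousAt (fun t : ℝ => u (x + t • e)) 0 :=
    ContinuousAt.comp (g := u) (by
      simpa using (hu.continuousOn.continuousAt (hΩ.mem_nhds hx))) hcont
  have hmin := isLocalMin_of_deriv_deriv_pos (hd2 ▸ hpos) hmax'.deriv_eq_zero hc0
  have hconst : (fun t : ℝ => u (x + t • e)) =ᶠ[nhds 0] fun _ => u (x + (0 : ℝ) • e) := by
    filter_upwards [hmin, hmax'] with t h1 h2 using le_antisymm h2 h1
  have : deriv (deriv fun t : ℝ => u (x + t • e)) 0 = 0 := by
    rw [hconst.deriv.deriv_eq]; simp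
  exact hpos.ne' (hd2 ▸ this)

theorem IsTorsion.neg (hN : 1 ≤ N) (hΩ : IsOpen Ω) (hbd : Bornology.IsBounded Ω)
    (hu : IsTorsion Ω u) (hx : x ∈ Ω) : u x < 0 := by
  obtain ⟨hc, hu2, hlap, h0⟩ := hu
  by_contra! hux
  obtain ⟨y, hy, hmax⟩ := hbd.isCompact_closure.exists_isMaxOn ⟨x, subset_closure hx⟩ hc
  obtain ⟨p, hp, hpmax⟩ : ∃ p ∈ Ω, IsMaxOn u (closure Ω) p := by
    by_cases hyΩ : y ∈ Ω
    · exact ⟨y, hyΩ, hmax⟩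
    · have : u y = 0 := h0 y (by rw [hΩ.frontier_eq]; exact ⟨hy, hyΩ⟩)
      exact ⟨x, hx, fun q hq => (this ▸ hmax hq : u q ≤ 0).trans hux⟩
  have hloc : IsLocalMax u p := hpmax.isLocalMax
    (Filter.mem_of_superset (hΩ.mem_nhds hp) subset_closure)
  have h1 : lap u p ≤ 0 := Finset.sum_nonpos fun i _ =>
    hessEntry_self_nonpos_of_isLocalMax hΩ hu2 hp hloc i
  rw [hlap p hp] at h1
  have : (1 : ℝ) ≤ N := by exact_mod_cast hN
  linarith

end MaximumPrinciple

section ZeroMean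

variable {N : ℕ} {Ω : Set (Euc N)} {u : Euc N → ℝ} {K : ℝ≥0}

theorem abs_le_mul_dist_of_frontier_eq_zero (hΩ : IsOpen Ω) (hc : ContinuousOn u (closure Ω))
    (hu : DifferentiableOn ℝ u Ω) (h0 : ∀ x ∈ frontier Ω, u x = 0)
    (hK : ∀ x ∈ Ω, ‖fderiv ℝ u x‖₊ ≤ K) {x y : Euc N} (hx : x ∈ Ω) (hy : y ∉ Ω) :
    |u x| ≤ K * dist x y := by
  have hne : Ω ≠ univ := fun h => hy (h ▸ mem_univ y)
  obtain ⟨p, hp, hd⟩ := exists_mem_frontier_infDist_compl_eq_dist hx hne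
  have hball : ball x (infDist x Ωᶜ) ⊆ Ω := ball_infDist_compl_subset
  have hpos : infDist x Ωᶜ ≠ 0 := fun h => by
    rw [hd, dist_eq_zero] at h
    exact (hΩ.frontier_eq ▸ hp).2 (h ▸ hx)
  have hlip : LipschitzOnWith K u (closure (ball x (infDist x Ωᶜ))) :=
    LipschitzOnWith.closure (hc.mono (closure_mono hball))
      ((convex_ball _ _).lipschitzOnWith_of_nnnorm_fderiv_le
        (fun q hq => hu.differentiableAt (hΩ.mem_nhds (hball hq))) fun q hq => hK q (hball hq))
  rw [closure_ball _ hpos] at hlip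
  have h1 := hlip.dist_le_mul x (mem_closedBall_self infDist_nonneg) p
    (by rw [mem_closedBall, dist_comm, hd])
  rw [h0 p hp, Real.dist_eq, sub_zero] at h1
  refine h1.trans ?_
  rw [← hd]
  exact mul_le_mul_of_nonneg_left (infDist_le_dist_of_mem hy) K.2

theorem hasDerivAt_cube_div {ε : ℝ} (hε : 0 < ε) (s : ℝ) :
    HasDerivAt (fun s : ℝ => s ^ 3 / (s ^ 2 + ε))
      ((s ^ 4 + 3 * ε * s ^ 2) / (s ^ 2 + ε) ^ 2) s := by
  have h := (hasDerivAt_pow 3 s).fun_div ((hasDerivAt_pow 2 s).add_const ε)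
    (by positivity : s ^ 2 + ε ≠ 0)
  refine h.congr_deriv ?_
  congr 1
  push_cast
  ring

theorem abs_cube_div_le {ε : ℝ} (hε : 0 < ε) (s : ℝ) :
    |s ^ 3 / (s ^ 2 + ε)| ≤ ε⁻¹ * |s| ^ 3 := by
  rw [abs_div, abs_pow, abs_of_pos (by positivity : 0 < s ^ 2 + ε), div_eq_inv_mul]
  gcongr
  nlinarith [sq_nonneg s]

theorem deriv_cube_div_le {ε : ℝ} (hε : 0 < ε) (s : ℝ) :
    |(s ^ 4 + 3 * ε * s ^ 2) / (s ^ 2 + ε) ^ 2| ≤ 2 := by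
  rw [abs_of_nonneg (by positivity), div_le_iff₀ (by positivity)]
  nlinarith [sq_nonneg s, mul_nonneg hε.le (sq_nonneg s), sq_nonneg (s ^ 2), sq_nonneg ε]

theorem hasFDerivAt_indicator_cube_div (hΩ : IsOpen Ω) (hc : ContinuousOn u (closure Ω))
    (hu : DifferentiableOn ℝ u Ω) (h0 : ∀ x ∈ frontier Ω, u x = 0)
    (hK : ∀ x ∈ Ω, ‖fderiv ℝ u x‖₊ ≤ K) {ε : ℝ} (hε : 0 < ε) (x : Euc N) :
    HasFDerivAt (Ω.indicator fun x => u x ^ 3 / (u x ^ 2 + ε))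
      (Ω.indicator (fun x => ((u x ^ 4 + 3 * ε * u x ^ 2) / (u x ^ 2 + ε) ^ 2) • fderiv ℝ u x) x)
      x := by
  by_cases hx : x ∈ Ω
  · rw [indicator_of_mem hx]
    refine ((hasDerivAt_cube_div hε (u x)).comp_hasFDerivAt x
      (hu.differentiableAt (hΩ.mem_nhds hx)).hasFDerivAt).congr_of_eventuallyEq ?_
    filter_upwards [hΩ.mem_nhds hx] with y hy
    simp [indicator_of_mem hy]
  · rw [indicator_of_notMem hx]
    refine Asymptotics.IsBigO.hasFDerivAt (n := 3) ?_ (by norm_num)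
    refine Asymptotics.IsBigO.of_bound (ε⁻¹ * K ^ 3) (Filter.Eventually.of_forall fun y => ?_)
    by_cases hy : y ∈ Ω
    · rw [indicator_of_mem hy, Real.norm_eq_abs, norm_pow, norm_norm, mul_assoc, ← mul_pow,
        ← dist_eq_norm]
      refine (abs_cube_div_le hε _).trans ?_
      gcongr
      exact abs_le_mul_dist_of_frontier_eq_zero hΩ hc hu h0 hK hy hx
    · rw [indicator_of_notMem hy, norm_zero]
      positivity

theorem setIntegral_fderiv_eq_zero (hΩ : IsOpen Ω) (hbd : Bornology.IsBounded Ω)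
    (hc : ContinuousOn u (closure Ω)) (hu : DifferentiableOn ℝ u Ω)
    (hne : ∀ x ∈ Ω, u x ≠ 0) (h0 : ∀ x ∈ frontier Ω, u x = 0)
    (hK : ∀ x ∈ Ω, ‖fderiv ℝ u x‖₊ ≤ K) (e : Euc N) : ∫ x in Ω, fderiv ℝ u x e = 0 := by
  set F : ℝ → Euc N → ℝ := fun ε => Ω.indicator fun x => u x ^ 3 / (u x ^ 2 + ε) with hF
  have hFd : ∀ ε > 0, ∀ x, HasFDerivAt (F ε) _ x := fun ε hε x =>
    hasFDerivAt_indicator_cube_div hΩ hc hu h0 hK hε x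
  have hbound : ∀ ε > 0, ∀ x, ‖fderiv ℝ (F ε) x e‖ ≤ Ω.indicator (fun _ => 2 * K * ‖e‖) x := by
    intro ε hε x
    rw [(hFd ε hε x).fderiv]
    by_cases hx : x ∈ Ω
    · rw [indicator_of_mem hx, indicator_of_mem hx, _root_.smul_apply, norm_smul,
        mul_assoc (2 : ℝ) K ‖e‖]
      refine mul_le_mul (deriv_cube_div_le hε _) ?_ (norm_nonneg _) zero_le_two
      exact ((fderiv ℝ u x).le_opNorm e).trans (by gcongr; exact hK x hx)
    · simp [hx]
  have hbint : Integrable (Ω.indicator fun _ : Euc N => 2 * (K : ℝ) * ‖e‖) :=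
    (integrable_indicator_iff hΩ.measurableSet).2
      (integrableOn_const hbd.measure_lt_top.ne)
  have hmeas : ∀ ε, AEStronglyMeasurable (fun x => fderiv ℝ (F ε) x e) volume := fun ε =>
    (measurable_fderiv_apply_const ℝ (F ε) e).aestronglyMeasurable
  have hzero : ∀ ε > 0, ∫ x, fderiv ℝ (F ε) x e = 0 := by
    intro ε hε
    have hcont : Continuous (F ε) :=
      continuous_iff_continuousAt.2 fun x => (hFd ε hε x).continuousAt
    have hsupp : HasCompactSupport (F ε) := by
      refine HasCompactSupport.intro hbd.isCompact_closure fun x hx => ?_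
      exact indicator_of_notMem (fun h => hx (subset_closure h)) _
    have := integral_mul_fderiv_eq_neg_fderiv_mul_of_integrable (μ := volume) (𝕜 := ℝ)
      (f := fun _ : Euc N => (1 : ℝ)) (g := F ε) (v := e) (by simp)
      (by simpa using hbint.mono' (hmeas ε) (.of_forall (hbound ε hε)))
      (by simpa using hcont.integrable_of_hasCompactSupport hsupp)
      (fun x _ => differentiableAt_const _) (fun x _ => (hFd ε hε x).differentiableAt)
    simpa using this
  have hlim := tendsto_integral_of_dominated_convergence (μ := volume)
    (F := fun (n : ℕ) x => fderiv ℝ (F (1 / ((n : ℝ) + 1))) x e)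
    (f := Ω.indicator fun x => fderiv ℝ u x e) _ (fun n => hmeas _) hbint
    (fun n => .of_forall (hbound _ Nat.one_div_pos_of_nat)) (.of_forall fun x => ?_)
  · rw [← integral_indicator hΩ.measurableSet]
    refine tendsto_nhds_unique hlim ?_
    simp only [hzero _ Nat.one_div_pos_of_nat]
    exact tendsto_const_nhds
  · simp only [(hFd _ Nat.one_div_pos_of_nat x).fderiv]
    by_cases hx : x ∈ Ω
    · simp only [indicator_of_mem hx, _root_.smul_apply, smul_eq_mul]
      have hs : u x ≠ 0 := hne x hx
      have hct : ContinuousAt (fun ε : ℝ =>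
          (u x ^ 4 + 3 * ε * u x ^ 2) / (u x ^ 2 + ε) ^ 2 * fderiv ℝ u x e) 0 := by
        refine ContinuousAt.mul (ContinuousAt.div (by fun_prop) (by fun_prop) ?_) (by fun_prop)
        simpa using hs
      have := hct.tendsto.comp (tendsto_one_div_add_atTop_nhds_zero_nat (𝕜 := ℝ))
      have he : (u x ^ 4 + 3 * 0 * u x ^ 2) / (u x ^ 2 + 0) ^ 2 * fderiv ℝ u x e =
          fderiv ℝ u x e := by
        field_simp
        ring
      rwa [he] at this
    · simp [hx]

end ZeroMean

section Deficit

variable {N : ℕ} {Ω : Set (Euc N)} {u : Euc N → ℝ} {x z : Euc N}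

theorem norm_sq_le_sum_sq_bilin (T : Euc N →L[ℝ] Euc N →L[ℝ] ℝ) :
    ‖T‖ ^ 2 ≤ ∑ i, ∑ j, T (EuclideanSpace.single i 1) (EuclideanSpace.single j 1) ^ 2 := by
  set S : ℝ := ∑ i, ∑ j, T (EuclideanSpace.single i 1) (EuclideanSpace.single j 1) ^ 2
  have hS : 0 ≤ S := Finset.sum_nonneg fun i _ => Finset.sum_nonneg fun j _ => sq_nonneg _
  have hrep : ∀ y : Euc N, y = ∑ i, y i • EuclideanSpace.single i (1 : ℝ) := fun y => by
    simpa using ((EuclideanSpace.basisFun (Fin N) ℝ).sum_repr y).symm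
  suffices h : ‖T‖ ≤ √S by
    calc ‖T‖ ^ 2 ≤ √S ^ 2 := by gcongr
      _ = S := Real.sq_sqrt hS
  refine T.opNorm_le_bound₂ (Real.sqrt_nonneg _) fun p q => ?_
  refine abs_le_of_sq_le_sq ?_ (by positivity)
  have e : T p q = ∑ k : Fin N × Fin N, (p k.1 * q k.2) *
      T (EuclideanSpace.single k.1 1) (EuclideanSpace.single k.2 1) := by
    conv_lhs => rw [hrep p, hrep q]
    simp only [map_sum, map_smul, _root_.sum_apply, _root_.smul_apply,
      smul_eq_mul, Finset.mul_sum]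
    rw [Fintype.sum_prod_type, Finset.sum_comm]
    refine Finset.sum_congr rfl fun i _ => Finset.sum_congr rfl fun j _ => by ring
  rw [e, mul_pow, mul_pow, Real.sq_sqrt hS, EuclideanSpace.real_norm_sq_eq,
    EuclideanSpace.real_norm_sq_eq, mul_assoc, mul_comm]
  refine (Finset.sum_mul_sq_le_sq_mul_sq _ _ _).trans_eq ?_
  rw [Fintype.sum_prod_type, Fintype.sum_prod_type,
    Finset.sum_mul_sum (f := fun i => p i ^ 2)]
  simp only [mul_pow, S]

theorem norm_fderiv_fderiv_sq_le_hessNormSq (h : DifferentiableAt ℝ (fderiv ℝ u) x) :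
    ‖fderiv ℝ (fderiv ℝ u) x‖ ^ 2 ≤ hessNormSq u x := by
  simp only [hessNormSq, hessEntry_eq h]
  exact norm_sq_le_sum_sq_bilin _

theorem measurable_hessNormSq (u : Euc N → ℝ) : Measurable (hessNormSq u) := by
  unfold hessNormSq hessEntry
  refine Finset.measurable_sum _ fun i _ => Finset.measurable_sum _ fun j _ => ?_
  exact (measurable_fderiv_apply_const ℝ _ _).pow_const 2

theorem contDiff_half_norm_sq (z : Euc N) : ContDiff ℝ 2 fun x : Euc N => ‖x - z‖ ^ 2 / 2 :=
  (contDiff_norm_sq ℝ |>.comp (contDiff_id.sub contDiff_const)).div_const 2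

theorem hasFDerivAt_half_norm_sq (z x : Euc N) :
    HasFDerivAt (fun x : Euc N => ‖x - z‖ ^ 2 / 2) (innerSL ℝ (x - z)) x := by
  have h := ((hasFDerivAt_id x).sub_const z).norm_sq.mul_const (2⁻¹ : ℝ)
  simp only [← div_eq_mul_inv, id] at h
  refine h.congr_fderiv ?_
  ext y
  simp

theorem fderiv_half_norm_sq_sub (hu : DifferentiableAt ℝ u x) :
    fderiv ℝ (fun x => ‖x - z‖ ^ 2 / 2 - u x) x = innerSL ℝ (x - z) - fderiv ℝ u x :=
  ((hasFDerivAt_half_norm_sq z x).sub hu.hasFDerivAt).fderiv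

theorem hessEntry_half_norm_sq_sub (hΩ : IsOpen Ω) (hu : ContDiffOn ℝ 2 u Ω) (hx : x ∈ Ω)
    (i j : Fin N) :
    hessEntry (fun x => ‖x - z‖ ^ 2 / 2 - u x) x i j = (if i = j then 1 else 0) -
      hessEntry u x i j := by
  have hev : (fun y => fderiv ℝ (fun x => ‖x - z‖ ^ 2 / 2 - u x) y (EuclideanSpace.single j 1))
      =ᶠ[nhds x] fun y => innerSL ℝ (y - z) (EuclideanSpace.single j 1) -
        fderiv ℝ u y (EuclideanSpace.single j 1) := by
    filter_upwards [hΩ.mem_nhds hx] with y hy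
    rw [fderiv_half_norm_sq_sub ((hu.differentiableOn two_ne_zero).differentiableAt
      (hΩ.mem_nhds hy))]
    rfl
  rw [hessEntry, hev.fderiv_eq, hessEntry]
  have h1 : HasFDerivAt (fun y => innerSL ℝ (y - z) (EuclideanSpace.single j (1 : ℝ)))
      ((innerSL ℝ).flip (EuclideanSpace.single j (1 : ℝ))) x := by
    have := ((innerSL ℝ).flip (EuclideanSpace.single j (1 : ℝ) : Euc N)).hasFDerivAt.comp x
      ((hasFDerivAt_id x).sub_const z)
    exact this.congr_fderiv (ContinuousLinearMap.comp_id _)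
  have h2 : DifferentiableAt ℝ (fun y => fderiv ℝ u y (EuclideanSpace.single j 1)) x :=
    (differentiableAt_fderiv_of_contDiffOn hΩ hu hx).clm_apply (differentiableAt_const _)
  rw [(h1.fun_sub h2.hasFDerivAt).fderiv]
  change ⟪(EuclideanSpace.single i (1 : ℝ) : Euc N), EuclideanSpace.single j (1 : ℝ)⟫ - _ = _
  rw [EuclideanSpace.inner_single_left]
  simp [PiLp.single_apply]

theorem hessNormSq_half_norm_sq_sub_le (hΩ : IsOpen Ω) (hu : ContDiffOn ℝ 2 u Ω) (hx : x ∈ Ω) :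
    hessNormSq (fun x => ‖x - z‖ ^ 2 / 2 - u x) x ≤ 2 * N ^ 2 + 2 * hessNormSq u x := by
  have h1 : ∀ i j, hessEntry (fun x => ‖x - z‖ ^ 2 / 2 - u x) x i j ^ 2 ≤
      2 + 2 * hessEntry u x i j ^ 2 := by
    intro i j
    rw [hessEntry_half_norm_sq_sub hΩ hu hx]
    have : (if i = j then (1 : ℝ) else 0) = 0 ∨ (if i = j then (1 : ℝ) else 0) = 1 := by
      split_ifs <;> simp
    rcases this with e | e <;> rw [e] <;> nlinarith [sq_nonneg (1 + hessEntry u x i j),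
      sq_nonneg (hessEntry u x i j)]
  calc hessNormSq (fun x => ‖x - z‖ ^ 2 / 2 - u x) x
      ≤ ∑ i : Fin N, ∑ j : Fin N, (2 + 2 * hessEntry u x i j ^ 2) :=
        Finset.sum_le_sum fun i _ => Finset.sum_le_sum fun j _ => h1 i j
    _ = _ := by
        simp only [Finset.sum_add_distrib, ← Finset.mul_sum, hessNormSq]
        simp
        ring

theorem setIntegral_inner_sub_barycenter (hΩ : IsOpen Ω) (hne : Ω.Nonempty)
    (hbd : Bornology.IsBounded Ω) (hz : z = ⨍ x in Ω, x) (e : Euc N) :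
    ∫ x in Ω, innerSL ℝ (x - z) e = 0 := by
  have hid : IntegrableOn (fun x : Euc N => x) Ω :=
    (continuous_id.continuousOn.integrableOn_compact hbd.isCompact_closure).mono_set subset_closure
  have hfin : volume Ω ≠ ∞ := hbd.measure_lt_top.ne
  have hpos : volume Ω ≠ 0 := (hΩ.measure_pos volume hne).ne'
  have h0 : ∫ x in Ω, (x - z) = 0 := by
    rw [integral_sub hid (integrableOn_const hfin), setIntegral_const, hz, measureReal_def,
      setAverage_eq, measureReal_def, smul_inv_smul₀, sub_self]
    exact (ENNReal.toReal_pos hpos hfin).ne'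
  have h1 := ((innerSL ℝ).flip e).integral_comp_comm (φ := fun x : Euc N => x - z)
    (hid.sub (integrableOn_const hfin))
  rw [h0, map_zero] at h1
  exact h1

end Deficit

theorem exists_boundary_oscillation_bound (N : ℕ) (hN : 2 ≤ N) {d r : ℝ} (hd : 0 < d)
    (hr : 0 < r) :
    ∃ C > (0 : ℝ), ∀ Ω : Set (Euc N), IsOpen Ω → IsConnected Ω → Bornology.IsBounded Ω →
      diam Ω ≤ d → (frontier Ω).Nonempty → (∀ p ∈ closure Ω, ∃ c, ReachesBall r Ω p c) →
      ∀ h : Euc N → ℝ, ContinuousOn h (closure Ω) → ContDiffOn ℝ 2 h Ω →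
      (∀ e, ∫ x in Ω, fderiv ℝ h x e = 0) →
      ∀ A M : ℝ, 0 ≤ A → (∀ x ∈ Ω, ‖fderiv ℝ h x‖ ≤ M) →
      ∫⁻ x in Ω, (ENNReal.ofReal (infDist x (frontier Ω)) * ‖fderiv ℝ (fderiv ℝ h) x‖ₑ) ^ 2 ≤
        ENNReal.ofReal (A ^ 2) →
      ∀ x ∈ closure Ω, ∀ y ∈ closure Ω, ‖h x - h y‖ₑ ≤ ENNReal.ofReal C *
        ∫⁻ τ in Ioc (0 : ℝ) 1, ENNReal.ofReal (min M (A * τ ^ (-(N : ℝ) / 2))) := by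
  obtain ⟨C₁, hC₁⟩ := exists_weighted_poincare.{0} N hd hr
  set m : ℝ := volume.real (closedBall (0 : Euc N) d)
  set κ : ℝ := volume.real (ball (0 : Euc N) r) with hκ
  have hm0 : 0 ≤ m := measureReal_nonneg
  have hκ0 : 0 < κ := ENNReal.toReal_pos (measure_ball_pos _ _ hr).ne' measure_ball_lt_top.ne
  set b : ℝ := 2 * C₁ * √m
  have hb : 0 ≤ b := by positivity
  set C₂ : ℝ := κ⁻¹ * (C₁ * (d * (b + m)) + d * (κ + (b + d * √κ / r)))
  have hC₂ : 0 < C₂ := by positivity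
  refine ⟨2 * C₂, by positivity, ?_⟩
  intro Ω hΩ hconn hbd hdiam hfr hreach h hc hh2 hmean A M hA hM hW
  set Φ : ℝ≥0∞ := ∫⁻ τ in Ioc (0 : ℝ) 1, ENNReal.ofReal (min M (A * τ ^ (-(N : ℝ) / 2))) with hΦ
  have hh : DifferentiableOn ℝ h Ω := hh2.differentiableOn two_ne_zero
  have hv : DifferentiableOn ℝ (fderiv ℝ h) Ω := fun x hx =>
    (differentiableAt_fderiv_of_contDiffOn hΩ hh2 hx).differentiableWithinAt
  obtain ⟨p, hp⟩ := hconn.nonempty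
  have hM0 : 0 ≤ M := (norm_nonneg _).trans (hM p hp)
  have hvol : volume Ω ≤ ENNReal.ofReal m := by
    rw [ofReal_measureReal measure_closedBall_lt_top.ne,
      ← Measure.addHaar_closedBall_center volume p d]
    exact measure_mono fun q hq => (dist_le_diam_of_mem hbd hq hp).trans hdiam
  have hfin : volume Ω ≠ ∞ := hbd.measure_lt_top.ne
  -- the gradient of `h` is controlled in `L¹`, first by `A`, then by `M`
  have hvm : Measurable fun x => ‖fderiv ℝ (fderiv ℝ h) x‖ₑ :=
    (measurable_fderiv ℝ (fderiv ℝ h)).enorm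
  have hIv : weightedGrad Ω (fderiv ℝ h) ≤ ENNReal.ofReal (√m * A) := by
    rw [← ENNReal.pow_le_pow_left_iff two_ne_zero]
    refine (lintegral_sq_le (by fun_prop)).trans ?_
    rw [← ENNReal.ofReal_pow (by positivity), mul_pow, Real.sq_sqrt hm0, ENNReal.ofReal_mul hm0]
    exact mul_le_mul' hvol hW
  have hvint : IntegrableOn (fderiv ℝ h) Ω :=
    Measure.integrableOn_of_bounded hfin (measurable_fderiv ℝ h).aestronglyMeasurable
      (by filter_upwards [self_mem_ae_restrict hΩ.measurableSet] with x hx using hM x hx)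
  have hvA : ∫⁻ x in Ω, ‖fderiv ℝ h x‖ₑ ≤ ENNReal.ofReal (b * A) := by
    obtain ⟨V, hV⟩ := hC₁ Ω hΩ hconn hbd hdiam hfr hreach _ (fderiv ℝ h) hv
      (hIv.trans_lt ENNReal.ofReal_lt_top).ne
    have h0 : ∫ x in Ω, fderiv ℝ h x = 0 := by
      ext e
      rw [ContinuousLinearMap.integral_apply hvint, hmean e]
      rfl
    have hVm : ‖V‖ₑ * volume Ω ≤ ∫⁻ x in Ω, ‖fderiv ℝ h x - V‖ₑ := by
      have h1 : ∫ x in Ω, (fderiv ℝ h x - V) = -(volume.real Ω • V) := by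
        rw [integral_sub hvint (integrableOn_const hfin), h0, setIntegral_const, zero_sub]
      have h2 := enorm_integral_le_lintegral_enorm (μ := volume.restrict Ω)
        (fun x => fderiv ℝ h x - V)
      rw [h1, enorm_neg, enorm_smul, Real.enorm_of_nonneg measureReal_nonneg,
        ofReal_measureReal hfin, mul_comm] at h2
      exact h2
    calc ∫⁻ x in Ω, ‖fderiv ℝ h x‖ₑ
        ≤ ∫⁻ x in Ω, (‖fderiv ℝ h x - V‖ₑ + ‖V‖ₑ) := by
          refine lintegral_mono fun x => ?_
          simpa using enorm_add_le (fderiv ℝ h x - V) V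
      _ = (∫⁻ x in Ω, ‖fderiv ℝ h x - V‖ₑ) + ‖V‖ₑ * volume Ω := by
          rw [lintegral_add_right _ measurable_const, setLIntegral_const]
      _ ≤ 2 * (C₁ * ENNReal.ofReal (√m * A)) := by
          rw [two_mul]
          have := hV.trans (mul_le_mul' le_rfl hIv)
          exact add_le_add this (hVm.trans this)
      _ = ENNReal.ofReal (b * A) := by
          rw [← ENNReal.ofReal_coe_nnreal, ← ENNReal.ofReal_mul C₁.coe_nonneg, ← ENNReal.ofReal_ofNat 2,
            ← ENNReal.ofReal_mul zero_le_two]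
          congr 1
          ring
  have hvM : ∫⁻ x in Ω, ‖fderiv ℝ h x‖ₑ ≤ ENNReal.ofReal (m * M) :=
    calc ∫⁻ x in Ω, ‖fderiv ℝ h x‖ₑ ≤ ∫⁻ x in Ω, ENNReal.ofReal M := by
          refine setLIntegral_mono' hΩ.measurableSet fun x hx => ?_
          rw [← ofReal_norm]
          exact ENNReal.ofReal_le_ofReal (hM x hx)
      _ ≤ _ := by
          rw [setLIntegral_const, mul_comm, ENNReal.ofReal_mul hm0]
          gcongr
  have hmin : ENNReal.ofReal (min M A) ≤ Φ :=
    calc ENNReal.ofReal (min M A) = ∫⁻ τ in Ioc (0 : ℝ) 1, ENNReal.ofReal (min M A) := by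
          rw [setLIntegral_const, Real.volume_Ioc]; simp
      _ ≤ Φ := by
          refine setLIntegral_mono' measurableSet_Ioc fun τ hτ => ENNReal.ofReal_le_ofReal ?_
          refine min_le_min le_rfl (le_mul_of_one_le_right hA ?_)
          refine Real.one_le_rpow_of_pos_of_le_one_of_nonpos hτ.1 hτ.2 ?_
          have : (0 : ℝ) ≤ N := N.cast_nonneg
          linarith
  have hIh : weightedGrad Ω h ≤ ENNReal.ofReal (d * (b + m)) * Φ :=
    calc weightedGrad Ω h ≤ ∫⁻ x in Ω, ENNReal.ofReal d * ‖fderiv ℝ h x‖ₑ := by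
          refine setLIntegral_mono' hΩ.measurableSet fun x hx => ?_
          gcongr
          obtain ⟨q, hq⟩ := hfr
          refine (infDist_le_dist_of_mem hq).trans ?_
          rw [← diam_closure] at hdiam
          exact (dist_le_diam_of_mem hbd.closure (subset_closure hx)
            (frontier_subset_closure hq)).trans hdiam
      _ = ENNReal.ofReal d * ∫⁻ x in Ω, ‖fderiv ℝ h x‖ₑ :=
          lintegral_const_mul' _ _ ENNReal.ofReal_ne_top
      _ ≤ ENNReal.ofReal d * ENNReal.ofReal ((b + m) * min M A) := by
          gcongr
          rcases min_choice M A with e | e <;> rw [e]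
          · refine hvM.trans (ENNReal.ofReal_le_ofReal ?_)
            gcongr
            linarith
          · refine hvA.trans (ENNReal.ofReal_le_ofReal ?_)
            gcongr
            linarith
      _ ≤ _ := by
          rw [ENNReal.ofReal_mul hd.le, mul_assoc, ENNReal.ofReal_mul (by positivity)]
          gcongr
  have hΦfin : Φ ≠ ∞ :=
    ((lintegral_min_rpow_le_self hM0 hA _).trans_lt ENNReal.ofReal_lt_top).ne
  obtain ⟨V, hV⟩ := hC₁ Ω hΩ hconn hbd hdiam hfr hreach ℝ h hh
    (hIh.trans_lt (ENNReal.mul_lt_top ENNReal.ofReal_lt_top hΦfin.lt_top)).ne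
  have key : ∀ x ∈ closure Ω, ‖h x - V‖ₑ ≤ ENNReal.ofReal C₂ * Φ := by
    intro x hx
    obtain ⟨c, hcx⟩ := hreach x hx
    have hκc : volume.real (ball c r) = κ := by
      rw [hκ, measureReal_def, measureReal_def, Measure.addHaar_ball_center]
    have h1 := enorm_boundary_sub_le hN hΩ hbd hdiam hfr hr hc hh hv hx hcx hA hW hb hvA hM V
    rw [← ofReal_measureReal measure_ball_lt_top.ne, hκc] at h1
    have h2 : ∫⁻ τ in Ioc (0 : ℝ) 1, ENNReal.ofReal
        ((κ + (b + d * √κ / r)) * min M (A * τ ^ (-(N : ℝ) / 2))) =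
        ENNReal.ofReal (κ + (b + d * √κ / r)) * Φ := by
      rw [hΦ, ← lintegral_const_mul' _ _ ENNReal.ofReal_ne_top]
      refine lintegral_congr fun τ => ?_
      rw [ENNReal.ofReal_mul (by positivity)]
    have h3 : ‖h x - V‖ₑ * ENNReal.ofReal κ ≤
        ENNReal.ofReal (C₁ * (d * (b + m)) + d * (κ + (b + d * √κ / r))) * Φ := by
      refine h1.trans ?_
      have hB : 0 ≤ κ + (b + d * √κ / r) := by positivity
      rw [h2]
      generalize κ + (b + d * √κ / r) = B at hB ⊢
      rw [ENNReal.ofReal_add (by positivity) (by positivity), add_mul,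
        ENNReal.ofReal_mul C₁.coe_nonneg, ENNReal.ofReal_coe_nnreal,
        ENNReal.ofReal_mul hd.le (q := B), mul_assoc, mul_assoc]
      exact add_le_add (hV.trans (mul_le_mul' le_rfl hIh)) le_rfl
    rw [ENNReal.ofReal_mul (by positivity), ENNReal.ofReal_inv_of_pos hκ0, mul_assoc, mul_comm,
      ← div_eq_mul_inv, ENNReal.le_div_iff_mul_le (by simp [hκ0]) (by simp)]
    exact h3
  intro x hx y hy
  calc ‖h x - h y‖ₑ = ‖(h x - V) - (h y - V)‖ₑ := by rw [sub_sub_sub_cancel_right]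
    _ ≤ ‖h x - V‖ₑ + ‖h y - V‖ₑ := enorm_sub_le
    _ ≤ ENNReal.ofReal C₂ * Φ + ENNReal.ofReal C₂ * Φ := add_le_add (key x hx) (key y hy)
    _ = _ := by
      rw [← two_mul, ENNReal.ofReal_mul zero_le_two, ENNReal.ofReal_ofNat, mul_assoc]

section Torsion

variable {N : ℕ} {Ω : Set (Euc N)} {u : Euc N → ℝ} {z : Euc N}

theorem norm_gradient_eq (u : Euc N → ℝ) (x : Euc N) : ‖gradient u x‖ = ‖fderiv ℝ u x‖ :=
  LinearIsometryEquiv.norm_map _ _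

theorem bddAbove_norm_gradient_half_norm_sq_sub (hΩ : IsOpen Ω) (hbd : Bornology.IsBounded Ω)
    (hu : DifferentiableOn ℝ u Ω) {K : ℝ} (hK : ∀ x ∈ Ω, ‖fderiv ℝ u x‖ ≤ K) :
    BddAbove ((fun x => ‖gradient (fun x => ‖x - z‖ ^ 2 / 2 - u x) x‖) '' Ω) := by
  obtain ⟨R, hR⟩ := hbd.subset_closedBall z
  refine ⟨R + K, ?_⟩
  rintro _ ⟨x, hx, rfl⟩
  simp only
  rw [norm_gradient_eq, fderiv_half_norm_sq_sub (hu.differentiableAt (hΩ.mem_nhds hx))]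
  refine (norm_sub_le _ _).trans (add_le_add ?_ (hK x hx))
  rw [innerSL_apply_norm, ← dist_eq_norm]
  exact hR hx

theorem IsTorsion.setIntegral_fderiv_half_norm_sq_sub (hN : 1 ≤ N) (hΩ : IsOpen Ω)
    (hne : Ω.Nonempty) (hbd : Bornology.IsBounded Ω) (hu : IsTorsion Ω u) {K : ℝ≥0}
    (hK : ∀ x ∈ Ω, ‖fderiv ℝ u x‖₊ ≤ K) (hz : z = ⨍ x in Ω, x) (e : Euc N) :
    ∫ x in Ω, fderiv ℝ (fun x => ‖x - z‖ ^ 2 / 2 - u x) x e = 0 := by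
  have hd : DifferentiableOn ℝ u Ω := hu.2.1.differentiableOn two_ne_zero
  have hfin : volume Ω ≠ ∞ := hbd.measure_lt_top.ne
  have hcont : Continuous fun x : Euc N => innerSL ℝ (x - z) e :=
    ((innerSL ℝ).flip e).continuous.comp (continuous_id.sub continuous_const)
  have h1 : IntegrableOn (fun x : Euc N => innerSL ℝ (x - z) e) Ω :=
    (hcont.continuousOn.integrableOn_compact hbd.isCompact_closure).mono_set subset_closure
  have h2 : IntegrableOn (fun x => fderiv ℝ u x e) Ω := by
    refine Measure.integrableOn_of_bounded (M := K * ‖e‖) hfin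
      (measurable_fderiv_apply_const ℝ u e).aestronglyMeasurable ?_
    filter_upwards [self_mem_ae_restrict hΩ.measurableSet] with x hx
    exact ((fderiv ℝ u x).le_opNorm e).trans (by gcongr; exact hK x hx)
  calc ∫ x in Ω, fderiv ℝ (fun x => ‖x - z‖ ^ 2 / 2 - u x) x e
      = ∫ x in Ω, (innerSL ℝ (x - z) e - fderiv ℝ u x e) := by
        refine setIntegral_congr_fun hΩ.measurableSet fun x hx => ?_
        rw [fderiv_half_norm_sq_sub (hd.differentiableAt (hΩ.mem_nhds hx))]
        rfl
    _ = 0 := by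
        rw [integral_sub h1 h2, setIntegral_inner_sub_barycenter hΩ hne hbd hz,
          setIntegral_fderiv_eq_zero hΩ hbd hu.1 hd (fun x hx => (hu.neg hN hΩ hbd hx).ne)
            hu.2.2.2 hK, sub_zero]

theorem lintegral_weighted_hessian_le (hΩ : IsOpen Ω) (hbd : Bornology.IsBounded Ω)
    (hfr : (frontier Ω).Nonempty) (hu : ContDiffOn ℝ 2 u Ω)
    (hinteg : IntegrableOn (fun x => hessNormSq u x) Ω) {h : Euc N → ℝ}
    (hh : h = fun x => ‖x - z‖ ^ 2 / 2 - u x) :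
    ∫⁻ x in Ω, (ENNReal.ofReal (infDist x (frontier Ω)) * ‖fderiv ℝ (fderiv ℝ h) x‖ₑ) ^ 2 ≤
      ENNReal.ofReal (√(∫ x in Ω, infDist x (frontier Ω) ^ 2 * hessNormSq h x) ^ 2) := by
  have hh2 : ContDiffOn ℝ 2 h Ω := hh ▸ (contDiff_half_norm_sq z).contDiffOn.sub hu
  have hnn : ∀ x, 0 ≤ hessNormSq h x := fun x =>
    Finset.sum_nonneg fun i _ => Finset.sum_nonneg fun j _ => sq_nonneg _
  have hnn' : ∀ x, 0 ≤ infDist x (frontier Ω) ^ 2 * hessNormSq h x := fun x =>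
    mul_nonneg (sq_nonneg _) (hnn x)
  have hdist : ∀ x ∈ Ω, infDist x (frontier Ω) ≤ diam (closure Ω) := fun x hx => by
    obtain ⟨q, hq⟩ := hfr
    exact (infDist_le_dist_of_mem hq).trans (dist_le_diam_of_mem hbd.closure (subset_closure hx)
      (frontier_subset_closure hq))
  have hdom : IntegrableOn (fun x => diam (closure Ω) ^ 2 * (2 * N ^ 2 + 2 * hessNormSq u x)) Ω :=
    ((integrableOn_const hbd.measure_lt_top.ne).add (hinteg.const_mul 2)).const_mul _
  have hI : IntegrableOn (fun x => infDist x (frontier Ω) ^ 2 * hessNormSq h x) Ω := by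
    refine hdom.mono' (((measurable_infDist.pow_const 2).mul
      (measurable_hessNormSq h)).aestronglyMeasurable) ?_
    filter_upwards [self_mem_ae_restrict hΩ.measurableSet] with x hx
    rw [Real.norm_of_nonneg (hnn' x)]
    have h1 := hessNormSq_half_norm_sq_sub_le (z := z) hΩ hu hx
    rw [← hh] at h1
    have h2 := hdist x hx
    have h3 : 0 ≤ infDist x (frontier Ω) := infDist_nonneg
    have h4 := hnn x
    gcongr
  rw [Real.sq_sqrt (setIntegral_nonneg hΩ.measurableSet fun x _ => hnn' x),
    ofReal_integral_eq_lintegral_ofReal hI (.of_forall hnn')]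
  refine setLIntegral_mono' hΩ.measurableSet fun x hx => ?_
  rw [← ofReal_norm, ← ENNReal.ofReal_mul infDist_nonneg,
    ← ENNReal.ofReal_pow (mul_nonneg infDist_nonneg (norm_nonneg _)), mul_pow]
  gcongr
  exact norm_fderiv_fderiv_sq_le_hessNormSq (differentiableAt_fderiv_of_contDiffOn hΩ hh2 hx)

end Torsion

/-- bound for `ρ_e - ρ_i` in terms of the weighted `L²` norm of `∇²h`
(weight `dist(x,∂Ω)²`). -/
theorem stmt_14 (N : ℕ) (hN : 2 ≤ N) (θ a d : ℝ) (hθ : θ ∈ Ioc (0:ℝ) (π / 2))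
    (ha : 0 < a) (hd : 0 < d) :
    ∃ C > (0:ℝ), ∀ Ω : Set (Euc N), IsOpen Ω → IsConnected Ω → Bornology.IsBounded Ω →
      Metric.diam Ω ≤ d → UnifConeCond θ a Ω →
      ∀ u : Euc N → ℝ, IsTorsion Ω u →
      ∀ g : Euc N → Euc N, ContinuousOn g (closure Ω) → (∀ x ∈ Ω, g x = gradient u x) →
      IntegrableOn (fun x => hessNormSq u x) Ω volume →
      ∀ z : Euc N, z = (⨍ x in Ω, x) →
      ∀ h : Euc N → ℝ, h = (fun x => ‖x - z‖ ^ 2 / 2 - u x) →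
      ∀ ρe ρi A M : ℝ,
        ρe = sSup ((fun x => dist x z) '' frontier Ω) →
        ρi = sInf ((fun x => dist x z) '' frontier Ω) →
        A = Real.sqrt (∫ x in Ω, infDist x (frontier Ω) ^ 2 * hessNormSq h x) →
        M = sSup ((fun x => ‖gradient h x‖) '' Ω) →
        ((N = 2 → ρe - ρi ≤ C * (A * max (Real.log (Real.exp 1 * M / A)) 1)) ∧
         (3 ≤ N → ρe - ρi ≤ C * (M ^ (((N:ℝ) - 2) / N) * A ^ ((2:ℝ) / N)))) := by
  have hN1 : 1 ≤ N := one_le_two.trans hN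
  obtain ⟨r, hr, hreach⟩ := exists_reachesBall hN1 hθ ha
  obtain ⟨C, hC, hosc⟩ := exists_boundary_oscillation_bound N hN hd hr
  refine ⟨6 * C / r, by positivity, ?_⟩
  intro Ω hΩ hconn hbd hdiam hcone u hu g hgc hg hinteg z hz h hh ρe ρi A M hρe hρi hA hM
  have : Nontrivial (Euc N) := by
    have : Nonempty (Fin N) := ⟨⟨0, hN1⟩⟩
    infer_instance
  have huniv : Ω ≠ univ := fun e => noncompact_univ (Euc N)
    (by simpa [e] using hbd.isCompact_closure)
  have hreach' := hreach Ω hΩ huniv hcone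
  obtain ⟨p, hp⟩ := hconn.nonempty
  obtain ⟨c, hc⟩ := hreach' p (subset_closure hp)
  obtain ⟨w, hw, hwr⟩ := exists_frontier_le_dist hN1 hΩ hbd hr
    (hc.ball_subset hr (subset_closure hp)) z
  have hfr : (frontier Ω).Nonempty := ⟨w, hw⟩
  have hcpt : IsCompact (frontier Ω) := hbd.isCompact_closure.of_isClosed_subset isClosed_frontier
    frontier_subset_closure
  have hdc : ContinuousOn (fun x => dist x z) (frontier Ω) := by fun_prop
  obtain ⟨xe, hxe, hxe_eq, hxe_max⟩ := hcpt.exists_sSup_image_eq_and_ge hfr hdc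
  obtain ⟨xi, hxi, hxi_eq, hxi_min⟩ := hcpt.exists_sInf_image_eq_and_le hfr hdc
  rw [← hρe] at hxe_eq
  rw [← hρi] at hxi_eq
  have hu1 : DifferentiableOn ℝ u Ω := hu.2.1.differentiableOn two_ne_zero
  obtain ⟨K, hK⟩ := hbd.isCompact_closure.exists_bound_of_continuousOn hgc
  have hK' : ∀ x ∈ Ω, ‖fderiv ℝ u x‖ ≤ K := fun x hx => by
    rw [← norm_gradient_eq, ← hg x hx]
    exact hK x (subset_closure hx)
  have hK0 : 0 ≤ K := (norm_nonneg _).trans (hK' p hp)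
  have hhc : ContinuousOn h (closure Ω) :=
    hh ▸ (contDiff_half_norm_sq z).continuous.continuousOn.sub hu.1
  have hh2 : ContDiffOn ℝ 2 h Ω := hh ▸ (contDiff_half_norm_sq z).contDiffOn.sub hu.2.1
  have hmean : ∀ e, ∫ x in Ω, fderiv ℝ h x e = 0 := by
    rw [hh]
    exact hu.setIntegral_fderiv_half_norm_sq_sub (K := ⟨K, hK0⟩) hN1 hΩ ⟨p, hp⟩ hbd hK' hz
  have hA0 : 0 ≤ A := hA ▸ Real.sqrt_nonneg _
  have hMle : ∀ x ∈ Ω, ‖fderiv ℝ h x‖ ≤ M := fun x hx => by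
    rw [← norm_gradient_eq, hM]
    refine le_csSup ?_ ⟨x, hx, rfl⟩
    rw [hh]
    exact bddAbove_norm_gradient_half_norm_sq_sub hΩ hbd hu1 hK'
  have hM0 : 0 ≤ M := (norm_nonneg _).trans (hMle p hp)
  have hW := lintegral_weighted_hessian_le hΩ hbd hfr hu.2.1 hinteg hh
  rw [← hA] at hW
  have hbd_osc := hosc Ω hΩ hconn hbd hdiam hfr hreach' h hhc hh2 hmean A M hA0 hMle hW
    xe (frontier_subset_closure hxe) xi (frontier_subset_closure hxi)
  have key : ∀ B, 0 ≤ B →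
      ∫⁻ τ in Ioc (0 : ℝ) 1, ENNReal.ofReal (min M (A * τ ^ (-(N : ℝ) / 2))) ≤
        ENNReal.ofReal B → ρe - ρi ≤ 2 * C / r * B := by
    intro B hB hΦ
    have h1 : h xe - h xi ≤ C * B := by
      have := hbd_osc.trans (mul_le_mul' le_rfl hΦ)
      rw [← ofReal_norm, ← ENNReal.ofReal_mul hC.le,
        ENNReal.ofReal_le_ofReal_iff (by positivity)] at this
      exact (le_abs_self _).trans this
    have h2 : h xe - h xi = (ρe ^ 2 - ρi ^ 2) / 2 := by
      rw [hh, hxe_eq, hxi_eq, dist_eq_norm, dist_eq_norm]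
      simp only [hu.2.2.2 xe hxe, hu.2.2.2 xi hxi]
      ring
    have h3 : r ≤ ρe := hxe_eq ▸ hwr.trans (hxe_max w hw)
    have h4 : ρi ≤ ρe := by
      rw [hxe_eq, hxi_eq]
      exact hxi_min xe hxe
    have h5 : 0 ≤ ρi := hxi_eq ▸ dist_nonneg
    rw [div_mul_eq_mul_div, le_div_iff₀ hr]
    nlinarith
  constructor
  · intro hN2
    have h1 := lintegral_min_inv_le hM0 hA0
    set B := A * max (Real.log (Real.exp 1 * M / A)) 1 with hB
    have hB0 : 0 ≤ B := mul_nonneg hA0 (zero_le_one.trans (le_max_right _ _))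
    refine (key B hB0 ?_).trans ?_
    · have : -(N : ℝ) / 2 = -1 := by rw [hN2]; norm_num
      rwa [this]
    · gcongr
      norm_num
  · intro hN3
    have h1 := key _ (by positivity) (lintegral_min_rpow_neg_half_le hN3 hM0 hA0)
    refine h1.trans_eq ?_
    ring
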